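/- arXiv:1003.4707 — 3 statements merged into one kernel-verified Lean document; each statement's English description precedes it below -/
import Mathlib

section
/- Let κ be an inaccessible cardinal. Then the following are equivalent: (1) κ is a Vopěnka cardinal; (2) for every set A ⊆ V_κ there is a cardinal α < κ that is extendible below κ for A. -/
open FirstOrder

universe u

/-- The relations of the standard language `L_std`: one binary relation symbol `ε` and one
unary relation symbol `R`. -/
inductive LStdRel : ℕ → Type
  | eps : LStdRel 2
  | r : LStdRel 1

/-- The standard first-order language `L_std`, with one binary relation symbol `ε` and one
unary relation symbol `R`. -/
def LStd : FirstOrder.Language := ⟨fun _ => Empty, LStdRel⟩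

/-- The `L_std`-structure coded by the ZFC sets `M` (the domain), `E` (a binary relation on `M`,
coded as a set of Kuratowski pairs) and `R` (a unary relation, coded as a subset of `M`). -/
def codedStructure (M E R : ZFSet.{u}) : LStd.Structure ↥M.toSet where
  funMap := fun f _ => f.elim
  RelMap
    | .eps, x => ZFSet.pair (x 0).1 (x 1).1 ∈ E
    | .r, x => (x 0).1 ∈ R

/-- The ZFC set `S` codes an `L_std`-structure: it is a triple `⟨M, E, R⟩` with `E` a binary
relation on `M` and `R` a unary relation on `M`. -/
def IsLStdCode (S : ZFSet.{u}) : Prop :=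
  ∃ M E R : ZFSet.{u}, S = M.pair (E.pair R) ∧
    (∀ p ∈ E, ∃ a ∈ M, ∃ b ∈ M, p = a.pair b) ∧ R ⊆ M

/-- The ZFC set `S` codes an ordinal `L_std`-structure: an `L_std`-structure whose domain is a
(von Neumann) ordinal. -/
def IsOrdinalLStdCode (S : ZFSet.{u}) : Prop :=
  ∃ M E R : ZFSet.{u}, S = M.pair (E.pair R) ∧ M.IsOrdinal ∧
    (∀ p ∈ E, ∃ a ∈ M, ∃ b ∈ M, p = a.pair b) ∧ R ⊆ M

/-- There is an `L_std`-elementary embedding from the structure coded by `S` into the structure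
coded by `T`. -/
def ElemEmbeddable (S T : ZFSet.{u}) : Prop :=
  ∃ M E R N E' R' : ZFSet.{u}, S = M.pair (E.pair R) ∧ T = N.pair (E'.pair R') ∧
    letI := codedStructure M E R
    letI := codedStructure N E' R'
    Nonempty (↥M.toSet ↪ₑ[LStd] ↥N.toSet)

/-- `VP A`: there are distinct members `M ≠ N` of the set `A` such that there is an
`L_std`-elementary embedding from `M` into `N`. -/
def VP (A : ZFSet.{u}) : Prop :=
  ∃ M ∈ A, ∃ N ∈ A, M ≠ N ∧ ElemEmbeddable M N

/-- `κ` is a Vopěnka cardinal: `κ` is inaccessible, and for every set `A ⊆ V_κ` of cardinality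
`κ` all of whose elements are `L_std`-structures, `VP A` holds. -/
def IsVopenka (κ : Cardinal.{u}) : Prop :=
  κ.IsInaccessible ∧
    ∀ A : ZFSet.{u}, (∀ x ∈ A, x.rank < κ.ord) →
      Cardinal.mk ↥A.toSet = Cardinal.lift.{u + 1} κ →
      (∀ x ∈ A, IsLStdCode x) → VP A

/-- The structure `⟨V_η, ∈, A ∩ V_η⟩`: the domain consists of the sets of rank `< η`, with `ε`
interpreted as membership and `R` interpreted as membership in the class `A`. -/
def VStructure (η : Ordinal.{u}) (A : Set ZFSet.{u}) :
    LStd.Structure {x : ZFSet.{u} // x.rank < η} where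
  funMap := fun f _ => f.elim
  RelMap
    | .eps, x => (x 0).1 ∈ (x 1).1
    | .r, x => (x 0).1 ∈ A

/-- The ZFC set `α` is a (von Neumann) cardinal: it is an ordinal and every one of its elements
has strictly smaller cardinality. -/
def ZFIsCardinal (α : ZFSet.{u}) : Prop :=
  α.IsOrdinal ∧ ∀ β ∈ α, Cardinal.mk ↥β.toSet < Cardinal.mk ↥α.toSet

/-- For von Neumann ordinals `α`, `η`, `ζ` and a class `A`: there is an elementary embedding
`j : ⟨V_η, ∈, A ∩ V_η⟩ → ⟨V_ζ, ∈, A ∩ V_ζ⟩` with critical point `α` (i.e. `j` fixes every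
ordinal `β < α` and moves `α`) such that `j α > η`. -/
def ExtWitness (A : Set ZFSet.{u}) (α η ζ : ZFSet.{u}) : Prop :=
  letI := VStructure η.rank A
  letI := VStructure ζ.rank A
  ∃ j : {x : ZFSet.{u} // x.rank < η.rank} ↪ₑ[LStd] {x : ZFSet.{u} // x.rank < ζ.rank},
    (∀ (β : ZFSet.{u}) (hβ : β.rank < η.rank), β ∈ α → (j ⟨β, hβ⟩).1 = β) ∧
    ∀ hα : α.rank < η.rank, (j ⟨α, hα⟩).1 ≠ α ∧ η ∈ (j ⟨α, hα⟩).1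

/-- `α` is `η`-extendible below `κ` for `A`: there are `ζ < κ` and an elementary embedding
`j : ⟨V_η, ∈, A ∩ V_η⟩ → ⟨V_ζ, ∈, A ∩ V_ζ⟩` with critical point `α` and `j α > η`. -/
def EtaExtendibleBelow (κ : Cardinal.{u}) (A : Set ZFSet.{u}) (α η : ZFSet.{u}) : Prop :=
  ∃ ζ : ZFSet.{u}, ζ.IsOrdinal ∧ ζ.rank < κ.ord ∧ ExtWitness A α η ζ

/-- `α` is extendible below `κ` for `A`: it is `η`-extendible below `κ` for `A` for every
ordinal `η` with `α < η < κ`. -/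
def ExtendibleBelow (κ : Cardinal.{u}) (A : Set ZFSet.{u}) (α : ZFSet.{u}) : Prop :=
  ∀ η : ZFSet.{u}, η.IsOrdinal → α ∈ η → η.rank < κ.ord → EtaExtendibleBelow κ A α η

/-- A transitive class of sets, indexed by `X` through `v`, read as an `LStd`-structure with true
membership and the unary predicate `P`. -/
structure IsTransModel {X : Type*} [LStd.Structure X] (v : X → ZFSet.{u}) (P : Set ZFSet.{u}) :
    Prop where
  inj : Function.Injective v
  trans : ∀ x, ∀ y ∈ v x, ∃ z, v z = y
  eps : ∀ x : Fin 2 → X, Language.Structure.RelMap (L := LStd) LStdRel.eps x ↔ v (x 0) ∈ v (x 1)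
  r : ∀ x : Fin 1 → X, Language.Structure.RelMap (L := LStd) LStdRel.r x ↔ v (x 0) ∈ P

/-- The `LStd`-structure `Y` is, through `w`, the structure with domain `D`, binary relation `E`
and unary relation `R`. -/
structure IsCodedBy {Y : Type*} [LStd.Structure Y] (w : Y → ZFSet.{u}) (D E R : ZFSet.{u}) :
    Prop where
  inj : Function.Injective w
  range : ∀ y, y ∈ D ↔ ∃ z, w z = y
  eps : ∀ x : Fin 2 → Y, Language.Structure.RelMap (L := LStd) LStdRel.eps x ↔
    ZFSet.pair (w (x 0)) (w (x 1)) ∈ E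
  r : ∀ x : Fin 1 → Y, Language.Structure.RelMap (L := LStd) LStdRel.r x ↔ w (x 0) ∈ R

namespace LStdFormula

open Language

variable {α : Type*} {n : ℕ}

/-- Weakening of variables under a quantifier. -/
def up (x : α ⊕ Fin n) : α ⊕ Fin (n + 1) := Sum.map id Fin.castSucc x

/-- The variable bound by the innermost quantifier. -/
def new : α ⊕ Fin (n + 1) := Sum.inr (Fin.last n)

/-- The formula `x ∈ y`. -/
def mem (x y : α ⊕ Fin n) : LStd.BoundedFormula α n :=
  BoundedFormula.rel (L := LStd) LStdRel.eps ![Term.var x, Term.var y]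

/-- The formula `x = y`. -/
def eq (x y : α ⊕ Fin n) : LStd.BoundedFormula α n := (Term.var x).bdEqual (Term.var y)

/-- The formula `R x`. -/
def pred (x : α ⊕ Fin n) : LStd.BoundedFormula α n :=
  BoundedFormula.rel (L := LStd) LStdRel.r ![Term.var x]

/-- The formula `c = {a, b}`. -/
def upair (c a b : α ⊕ Fin n) : LStd.BoundedFormula α n :=
  ((mem new (up c)).iff (eq new (up a) ⊔ eq new (up b))).all

/-- The formula `p = ⟨a, b⟩`. -/
def pair (p a b : α ⊕ Fin n) : LStd.BoundedFormula α n :=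
  (upair (up new) (up (up a)) (up (up a)) ⊓
    (upair new (up (up a)) (up (up b)) ⊓ upair (up (up p)) (up new) new)).ex.ex

/-- The formula `⟨a, b⟩ ∈ e`. -/
def pairMem (a b e : α ⊕ Fin n) : LStd.BoundedFormula α n :=
  (pair new (up a) (up b) ⊓ mem new (up e)).ex

@[simp]
theorem elim_up {X : Type*} (s : α → X) (t : Fin n → X) (a : X) (x : α ⊕ Fin n) :
    Sum.elim s (Fin.snoc t a : Fin (n + 1) → X) (up x) = Sum.elim s t x := by
  cases x <;> simp [up]

@[simp]
theorem elim_new {X : Type*} (s : α → X) (t : Fin n → X) (a : X) :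
    Sum.elim s (Fin.snoc t a : Fin (n + 1) → X) new = a := by
  simp [new]

variable {X : Type*} [LStd.Structure X] {v : X → ZFSet.{u}} {P : Set ZFSet.{u}}

@[simp]
theorem realize_eq (s : α → X) (t : Fin n → X) (x y : α ⊕ Fin n) :
    (eq x y).Realize s t ↔ Sum.elim s t x = Sum.elim s t y := by
  simp [eq]

theorem realize_mem (hX : IsTransModel v P) (s : α → X) (t : Fin n → X) (x y : α ⊕ Fin n) :
    (mem x y).Realize s t ↔ v (Sum.elim s t x) ∈ v (Sum.elim s t y) := by
  exact hX.eps _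

theorem realize_pred (hX : IsTransModel v P) (s : α → X) (t : Fin n → X) (x : α ⊕ Fin n) :
    (pred x).Realize s t ↔ v (Sum.elim s t x) ∈ P := by
  exact hX.r _

theorem realize_upair (hX : IsTransModel v P) (s : α → X) (t : Fin n → X) (c a b : α ⊕ Fin n) :
    (upair c a b).Realize s t ↔
      v (Sum.elim s t c) = {v (Sum.elim s t a), v (Sum.elim s t b)} := by
  simp only [upair, BoundedFormula.realize_all, BoundedFormula.realize_iff, realize_mem hX,
    BoundedFormula.realize_sup, realize_eq, elim_up, elim_new]
  constructor
  · intro h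
    ext z
    rw [ZFSet.mem_pair]
    constructor
    · intro hz
      obtain ⟨y, rfl⟩ := hX.trans _ _ hz
      exact ((h y).1 hz).imp (congrArg v) (congrArg v)
    · rintro (rfl | rfl)
      · exact (h _).2 (Or.inl rfl)
      · exact (h _).2 (Or.inr rfl)
  · intro h a
    rw [h, ZFSet.mem_pair, hX.inj.eq_iff, hX.inj.eq_iff]

theorem realize_pair (hX : IsTransModel v P) (s : α → X) (t : Fin n → X) (p a b : α ⊕ Fin n) :
    (pair p a b).Realize s t ↔
      v (Sum.elim s t p) = (v (Sum.elim s t a)).pair (v (Sum.elim s t b)) := by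
  simp only [pair, BoundedFormula.realize_ex, BoundedFormula.realize_inf, realize_upair hX,
    elim_up, elim_new]
  constructor
  · rintro ⟨x, y, hx, hy, h⟩
    rw [h, hx, hy, ZFSet.pair_eq_singleton]
    rfl
  · intro h
    obtain ⟨x, hx⟩ := hX.trans (Sum.elim s t p) {v (Sum.elim s t a)} (by rw [h]; simp [ZFSet.pair])
    obtain ⟨y, hy⟩ := hX.trans (Sum.elim s t p) {v (Sum.elim s t a), v (Sum.elim s t b)}
      (by rw [h]; simp [ZFSet.pair])
    exact ⟨x, y, by rw [hx, ZFSet.pair_eq_singleton], hy, by rw [h, hx, hy]; rfl⟩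

theorem realize_pairMem (hX : IsTransModel v P) (s : α → X) (t : Fin n → X) (a b e : α ⊕ Fin n) :
    (pairMem a b e).Realize s t ↔
      (v (Sum.elim s t a)).pair (v (Sum.elim s t b)) ∈ v (Sum.elim s t e) := by
  simp only [pairMem, BoundedFormula.realize_ex, BoundedFormula.realize_inf, realize_pair hX,
    realize_mem hX, elim_up, elim_new]
  constructor
  · rintro ⟨x, hx, h⟩
    rwa [← hx]
  · intro h
    obtain ⟨x, hx⟩ := hX.trans _ _ h
    exact ⟨x, hx, by rwa [hx]⟩

end LStdFormula

open Language in
theorem term_eq_var {β : Type*} (t : LStd.Term β) : ∃ x, t = Term.var x := by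
  cases t with
  | var x => exact ⟨x, rfl⟩
  | func f => exact f.elim

theorem elim_map {α X Y : Type*} {n : ℕ} (g : Y → X) (d : Fin 3 → X) (s : α → Y) (t : Fin n → Y)
    (x : α ⊕ Fin n) : Sum.elim (Sum.elim (g ∘ s) d) (g ∘ t) (Sum.map Sum.inl id x) =
      g (Sum.elim s t x) := by
  cases x <;> rfl

open Language LStdFormula in
/-- Relativization: satisfaction in a structure coded by `⟨D, E, R⟩` is definable from
`D`, `E`, `R` in every transitive model. -/
theorem exists_relativization {α : Type*} {n : ℕ} (φ : LStd.BoundedFormula α n) :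
    ∃ ψ : LStd.BoundedFormula (α ⊕ Fin 3) n,
      ∀ {X Y : Type (u + 1)} [LStd.Structure X] [LStd.Structure Y] {v : X → ZFSet.{u}}
        {P : Set ZFSet.{u}} {w : Y → ZFSet.{u}} {d : Fin 3 → X} (_ : IsTransModel v P)
        (_ : IsCodedBy w (v (d 0)) (v (d 1)) (v (d 2))) (g : Y → X) (_ : ∀ y, v (g y) = w y)
        (s : α → Y) (t : Fin n → Y),
        ψ.Realize (Sum.elim (g ∘ s) d) (g ∘ t) ↔ φ.Realize s t := by
  induction φ with
  | falsum => exact ⟨⊥, by intros; rfl⟩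
  | equal t₁ t₂ =>
    obtain ⟨x, rfl⟩ := term_eq_var t₁
    obtain ⟨y, rfl⟩ := term_eq_var t₂
    refine ⟨eq (Sum.map Sum.inl id x) (Sum.map Sum.inl id y), ?_⟩
    intro X Y _ _ v P w d hX hY g hg s t
    rw [realize_eq, elim_map, elim_map, ← hX.inj.eq_iff, hg, hg, hY.inj.eq_iff]
    rfl
  | @rel n k R ts =>
    cases R with
    | eps =>
      obtain ⟨x, hx⟩ := term_eq_var (ts 0)
      obtain ⟨y, hy⟩ := term_eq_var (ts 1)
      refine ⟨pairMem (Sum.map Sum.inl id x) (Sum.map Sum.inl id y) (Sum.inl (Sum.inr 1)), ?_⟩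
      intro X Y _ _ v P w d hX hY g hg s t
      rw [realize_pairMem hX, elim_map, elim_map, hg, hg]
      refine Iff.trans ?_ (hY.eps fun i => (ts i).realize (Sum.elim s t)).symm
      simp only [hx, hy, Term.realize_var]
      rfl
    | r =>
      obtain ⟨x, hx⟩ := term_eq_var (ts 0)
      refine ⟨mem (Sum.map Sum.inl id x) (Sum.inl (Sum.inr 2)), ?_⟩
      intro X Y _ _ v P w d hX hY g hg s t
      rw [realize_mem hX, elim_map, hg]
      refine Iff.trans ?_ (hY.r fun i => (ts i).realize (Sum.elim s t)).symm
      simp only [hx, Term.realize_var]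
      rfl
  | imp φ₁ φ₂ ih₁ ih₂ =>
    obtain ⟨ψ₁, h₁⟩ := ih₁
    obtain ⟨ψ₂, h₂⟩ := ih₂
    refine ⟨ψ₁.imp ψ₂, ?_⟩
    intro X Y _ _ v P w d hX hY g hg s t
    rw [BoundedFormula.realize_imp, BoundedFormula.realize_imp, h₁ hX hY g hg, h₂ hX hY g hg]
  | all φ ih =>
    obtain ⟨ψ, h⟩ := ih
    refine ⟨((mem new (Sum.inl (Sum.inr 0))).imp ψ).all, ?_⟩
    intro X Y _ _ v P w d hX hY g hg s t
    simp only [BoundedFormula.realize_all, BoundedFormula.realize_imp, realize_mem hX, elim_new]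
    constructor
    · intro H y
      have := H (g y) ((hY.range _).2 ⟨y, (hg y).symm⟩)
      rwa [← Fin.comp_snoc, h hX hY g hg] at this
    · intro H x hx
      obtain ⟨y, hy⟩ := (hY.range _).1 hx
      rw [← hg, hX.inj.eq_iff] at hy
      rw [← hy, ← Fin.comp_snoc, h hX hY g hg]
      exact H y

open Language LStdFormula

section Elementary

variable {X X' : Type (u + 1)} [LStd.Structure X] [LStd.Structure X'] {v : X → ZFSet.{u}}
  {v' : X' → ZFSet.{u}} {P P' : Set ZFSet.{u}}

theorem IsTransModel.map_upair (hX : IsTransModel v P) (hX' : IsTransModel v' P')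
    (j : X ↪ₑ[LStd] X') {c a b : X} (h : v c = {v a, v b}) : v' (j c) = {v' (j a), v' (j b)} := by
  have := (j.map_boundedFormula (upair (n := 3) (α := Empty) (.inr 0) (.inr 1) (.inr 2))
    Empty.elim ![c, a, b]).2 (by rw [realize_upair hX]; exact h)
  rw [realize_upair hX'] at this
  exact this

theorem IsTransModel.map_pair (hX : IsTransModel v P) (hX' : IsTransModel v' P')
    (j : X ↪ₑ[LStd] X') {c a b : X} (h : v c = (v a).pair (v b)) :
    v' (j c) = (v' (j a)).pair (v' (j b)) := by
  have := (j.map_boundedFormula (pair (n := 3) (α := Empty) (.inr 0) (.inr 1) (.inr 2))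
    Empty.elim ![c, a, b]).2 (by rw [realize_pair hX]; exact h)
  rw [realize_pair hX'] at this
  exact this

theorem IsTransModel.map_mem (hX : IsTransModel v P) (hX' : IsTransModel v' P')
    (j : X ↪ₑ[LStd] X') {a b : X} : v' (j a) ∈ v' (j b) ↔ v a ∈ v b := by
  have := (j.map_boundedFormula (mem (n := 2) (α := Empty) (.inr 0) (.inr 1)) Empty.elim ![a, b])
  rw [realize_mem hX', realize_mem hX] at this
  exact this

theorem IsTransModel.map_pred (hX : IsTransModel v P) (hX' : IsTransModel v' P')
    (j : X ↪ₑ[LStd] X') {a : X} : v' (j a) ∈ P' ↔ v a ∈ P := by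
  have := (j.map_boundedFormula (pred (n := 1) (α := Empty) (.inr 0)) Empty.elim ![a])
  rw [realize_pred hX', realize_pred hX] at this
  exact this

theorem IsTransModel.map_empty (hX : IsTransModel v P) (hX' : IsTransModel v' P')
    (j : X ↪ₑ[LStd] X') {a : X} (h : v a = ∅) : v' (j a) = ∅ := by
  have := (j.map_boundedFormula (mem (n := 2) (α := Empty) (.inr 1) (.inr 0)).not.all
    Empty.elim ![a]).2 (by
      simp only [BoundedFormula.realize_all, BoundedFormula.realize_not, realize_mem hX]
      intro b hb
      exact ZFSet.notMem_empty (v b) (h ▸ hb))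
  simp only [BoundedFormula.realize_all, BoundedFormula.realize_not, realize_mem hX'] at this
  rw [ZFSet.eq_empty]
  intro y hy
  obtain ⟨z, rfl⟩ := hX'.trans _ _ hy
  exact this z hy

/-- An elementary embedding of transitive models restricts to an elementary embedding between
the structures coded by an element and its image. -/
theorem IsTransModel.exists_restrict (hX : IsTransModel v P) (hX' : IsTransModel v' P')
    (j : X ↪ₑ[LStd] X') {D E R : X} {Y Y' : Type (u + 1)} [LStd.Structure Y] [LStd.Structure Y']
    {w : Y → ZFSet.{u}} {w' : Y' → ZFSet.{u}} (hY : IsCodedBy w (v D) (v E) (v R))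
    (hY' : IsCodedBy w' (v' (j D)) (v' (j E)) (v' (j R))) :
    ∃ k : Y ↪ₑ[LStd] Y', ∀ y x, w y = v x → w' (k y) = v' (j x) := by
  have hg (y : Y) : ∃ x, v x = w y := hX.trans D _ ((hY.range _).2 ⟨y, rfl⟩)
  choose g hg using hg
  have hg' (y : Y') : ∃ x, v' x = w' y := hX'.trans (j D) _ ((hY'.range _).2 ⟨y, rfl⟩)
  choose g' hg' using hg'
  have hk (y : Y) : ∃ z, w' z = v' (j (g y)) :=
    (hY'.range _).1 ((hX.map_mem hX' j).2 (by rw [hg]; exact (hY.range _).2 ⟨y, rfl⟩))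
  choose k hk using hk
  refine ⟨⟨k, fun n φ s => ?_⟩, fun y x h => ?_⟩
  · obtain ⟨ψ, hψ⟩ := exists_relativization φ
    have h₁ := hψ (d := ![D, E, R]) hX hY g hg s default
    have h₂ := hψ (d := ![j D, j E, j R]) hX' hY' g' hg' (k ∘ s) default
    have h₃ := j.map_boundedFormula ψ (Sum.elim (g ∘ s) ![D, E, R]) (g ∘ default)
    have e₁ : (j ∘ Sum.elim (g ∘ s) ![D, E, R] : Fin n ⊕ Fin 3 → X') =
        Sum.elim (g' ∘ k ∘ s) ![j D, j E, j R] := by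
      funext x
      rcases x with x | x
      · exact hX'.inj (by simp [hg', hk])
      · fin_cases x <;> rfl
    rw [e₁] at h₃
    rw [Formula.Realize, Formula.Realize, ← h₁, ← h₃, ← h₂]
    refine iff_of_eq ?_
    congr 1
    exact Subsingleton.elim _ _
  · rw [← hg, hX.inj.eq_iff] at h
    rw [← h]
    exact hk y

end Elementary

theorem isTransModel_vStructure (θ : Ordinal.{u}) (P : Set ZFSet.{u}) :
    letI := VStructure θ P
    IsTransModel (Subtype.val : {x : ZFSet.{u} // x.rank < θ} → ZFSet.{u}) P := by
  let _ := VStructure θ P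
  exact ⟨Subtype.val_injective,
    fun x y hy => ⟨⟨y, (ZFSet.rank_lt_of_mem hy).trans x.2⟩, rfl⟩,
    fun _ => Iff.rfl, fun _ => Iff.rfl⟩

theorem isCodedBy_codedStructure (M E R : ZFSet.{u}) :
    letI := codedStructure M E R
    IsCodedBy (Subtype.val : ↥M.toSet → ZFSet.{u}) M E R := by
  let _ := codedStructure M E R
  exact ⟨Subtype.val_injective, fun y => ⟨fun h => ⟨⟨y, h⟩, rfl⟩, by rintro ⟨z, rfl⟩; exact z.2⟩,
    fun _ => Iff.rfl, fun _ => Iff.rfl⟩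

namespace ZFSet

open scoped ZFSet

/-- The membership relation on `V_η`. -/
noncomputable def vMem (η : Ordinal.{u}) : ZFSet.{u} :=
  ((V_ η).prod (V_ η)).sep fun p => ∃ a b : ZFSet.{u}, p = a.pair b ∧ a ∈ b

/-- The trace of the class `P` on `V_η`. -/
noncomputable def vPred (η : Ordinal.{u}) (P : Set ZFSet.{u}) : ZFSet.{u} :=
  (V_ η).sep (· ∈ P)

/-- The code of the structure `⟨V_η, ∈, P ∩ V_η⟩`. -/
noncomputable def vCode (η : Ordinal.{u}) (P : Set ZFSet.{u}) : ZFSet.{u} :=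
  (V_ η).pair ((vMem η).pair (vPred η P))

theorem pair_mem_vMem {η : Ordinal.{u}} {a b : ZFSet.{u}} :
    a.pair b ∈ vMem η ↔ a.rank < η ∧ b.rank < η ∧ a ∈ b := by
  rw [vMem, mem_sep, pair_mem_prod, mem_vonNeumann, mem_vonNeumann, and_assoc]
  refine and_congr_right fun _ => and_congr_right fun _ => ⟨?_, fun h => ⟨a, b, rfl, h⟩⟩
  rintro ⟨a', b', h, h'⟩
  obtain ⟨rfl, rfl⟩ := pair_inj.1 h
  exact h'

theorem mem_vPred {η : Ordinal.{u}} {P : Set ZFSet.{u}} {a : ZFSet.{u}} :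
    a ∈ vPred η P ↔ a.rank < η ∧ a ∈ P := by
  rw [vPred, mem_sep, mem_vonNeumann]

theorem isLStdCode_vCode (η : Ordinal.{u}) (P : Set ZFSet.{u}) : IsLStdCode (vCode η P) := by
  refine ⟨_, _, _, rfl, fun p hp => ?_, fun a ha => ?_⟩
  · obtain ⟨a, ha, b, hb, rfl⟩ := mem_prod.1 (mem_sep.1 hp).1
    exact ⟨a, ha, b, hb, rfl⟩
  · exact (mem_sep.1 ha).1

theorem rank_pair_eq (a b : ZFSet.{u}) :
    (a.pair b).rank = Order.succ (Order.succ (max a.rank b.rank)) := by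
  rw [pair, rank_pair, rank_singleton, rank_pair]
  simp only [Order.succ_eq_add_one, max_add_add_right]
  simp

theorem rank_pair_lt {a b : ZFSet.{u}} {o : Ordinal.{u}} (ho : Order.IsSuccLimit o)
    (ha : a.rank < o) (hb : b.rank < o) : (a.pair b).rank < o := by
  rw [rank_pair_eq]
  exact ho.succ_lt (ho.succ_lt (max_lt ha hb))

theorem rank_fst_lt_rank_pair (a b : ZFSet.{u}) : a.rank < (a.pair b).rank := by
  rw [rank_pair_eq]
  exact (le_max_left _ _).trans_lt ((Order.lt_succ _).trans (Order.lt_succ _))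

theorem rank_snd_lt_rank_pair (a b : ZFSet.{u}) : b.rank < (a.pair b).rank := by
  rw [rank_pair_eq]
  exact (le_max_right _ _).trans_lt ((Order.lt_succ _).trans (Order.lt_succ _))

theorem rank_vCode_lt {η o : Ordinal.{u}} (P : Set ZFSet.{u}) (ho : Order.IsSuccLimit o)
    (hη : η < o) : (vCode η P).rank < o := by
  have hV : (V_ η).rank < o := by rwa [rank_vonNeumann]
  have hs {x : ZFSet.{u}} (h : ∀ y ∈ x, y.rank < Order.succ (Order.succ η)) : x.rank < o :=
    ((rank_le_iff).2 h).trans_lt (ho.succ_lt (ho.succ_lt hη))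
  refine rank_pair_lt ho hV (rank_pair_lt ho (hs fun p hp => ?_) (hs fun p hp => ?_))
  · obtain ⟨a, ha, b, hb, rfl⟩ := mem_prod.1 (mem_sep.1 hp).1
    rw [mem_vonNeumann] at ha hb
    rw [rank_pair_eq]
    exact Order.succ_lt_succ (Order.succ_lt_succ (max_lt ha hb))
  · have := (mem_vPred.1 hp).1
    exact this.trans ((Order.lt_succ _).trans (Order.lt_succ _))

end ZFSet

open ZFSet

theorem isTransModel_vCode (θ : Ordinal.{u}) (P : Set ZFSet.{u}) :
    letI := codedStructure (vonNeumann θ) (vMem θ) (vPred θ P)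
    IsTransModel (Subtype.val : ↥(vonNeumann θ).toSet → ZFSet.{u}) P := by
  let _ := codedStructure (vonNeumann θ) (vMem θ) (vPred θ P)
  have hr (x : ↥(vonNeumann θ).toSet) : x.1.rank < θ := mem_vonNeumann.1 x.2
  refine ⟨Subtype.val_injective, fun x y hy => ?_, fun x => ?_, fun x => ?_⟩
  · exact ⟨⟨y, mem_vonNeumann.2 ((rank_lt_of_mem hy).trans (hr x))⟩, rfl⟩
  · exact pair_mem_vMem.trans ⟨fun h => h.2.2, fun h => ⟨hr _, hr _, h⟩⟩
  · exact mem_vPred.trans ⟨fun h => h.2, fun h => ⟨hr _, h⟩⟩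

theorem isCodedBy_vStructure (η : Ordinal.{u}) (P : Set ZFSet.{u}) :
    letI := VStructure η P
    IsCodedBy (Subtype.val : {x : ZFSet.{u} // x.rank < η} → ZFSet.{u})
      (vonNeumann η) (vMem η) (vPred η P) := by
  let _ := VStructure η P
  refine ⟨Subtype.val_injective, fun y => ?_, fun x => ?_, fun x => ?_⟩
  · rw [mem_vonNeumann]
    exact ⟨fun h => ⟨⟨y, h⟩, rfl⟩, by rintro ⟨z, rfl⟩; exact z.2⟩
  · exact (pair_mem_vMem.trans ⟨fun h => h.2.2, fun h => ⟨(x 0).2, (x 1).2, h⟩⟩).symm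
  · exact (mem_vPred.trans ⟨fun h => h.2, fun h => ⟨(x 0).2, h⟩⟩).symm

theorem Ordinal.exists_isSuccLimit_between {κ : Cardinal.{u}} (hκ : κ.IsInaccessible)
    {o : Ordinal.{u}} (ho : o < κ.ord) : ∃ l, Order.IsSuccLimit l ∧ o < l ∧ l < κ.ord := by
  have hω : Ordinal.omega0 < κ.ord := by
    rw [← Cardinal.ord_aleph0]
    exact Cardinal.ord_lt_ord.2 hκ.aleph0_lt
  refine ⟨o + Ordinal.omega0, Ordinal.isSuccLimit_add o Ordinal.isSuccLimit_omega0, ?_, ?_⟩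
  · exact lt_add_of_pos_right _ Ordinal.omega0_pos
  · exact Ordinal.isPrincipal_add_ord hκ.aleph0_lt.le ho hω

theorem ZFSet.exists_le_rank {κ : Cardinal.{u}} (hκ : κ.IsInaccessible) {A : ZFSet.{u}}
    (hA : Cardinal.mk ↥A.toSet = Cardinal.lift.{u + 1} κ) {o : Ordinal.{u}} (ho : o < κ.ord) :
    ∃ x ∈ A, o ≤ x.rank := by
  by_contra! h
  have hsub : A ⊆ vonNeumann o := fun x hx => mem_vonNeumann.2 (h x hx)
  have h₁ : A.card = κ := Cardinal.lift_injective (cardinalMk_coe_sort.symm.trans hA)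
  have h₂ := card_mono hsub
  rw [card_vonNeumann, h₁] at h₂
  have h₃ := Cardinal.preBeth_strictMono ho
  rw [hκ.preBeth_ord] at h₃
  exact h₃.not_ge h₂

theorem isVopenka_of_extendibleBelow {κ : Cardinal.{u}} (hκ : κ.IsInaccessible)
    (h : ∀ A : ZFSet.{u}, (∀ x ∈ A, x.rank < κ.ord) →
      ∃ α : ZFSet.{u}, ZFIsCardinal α ∧ α.rank < κ.ord ∧ ExtendibleBelow κ A.toSet α) :
    IsVopenka κ := by
  refine ⟨hκ, fun A hr hc hcode => ?_⟩
  have hlim : Order.IsSuccLimit κ.ord := Cardinal.isSuccLimit_ord hκ.aleph0_lt.le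
  let B : ZFSet.{u} := ZFSet.range fun x : ↥A => x.1.pair x.1.rank.toZFSet
  have hB (y : ZFSet.{u}) : y ∈ B ↔ ∃ x ∈ A, x.pair x.rank.toZFSet = y := by
    rw [ZFSet.mem_range]
    exact ⟨fun ⟨x, hx⟩ => ⟨x.1, x.2, hx⟩, fun ⟨x, hx, h⟩ => ⟨⟨x, hx⟩, h⟩⟩
  obtain ⟨α, hα, hακ, hext⟩ := h B fun y hy => by
    obtain ⟨x, hx, rfl⟩ := (hB y).1 hy
    exact rank_pair_lt hlim (hr x hx) (by rw [Ordinal.rank_toZFSet]; exact hr x hx)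
  obtain ⟨M, hM, hαM⟩ := ZFSet.exists_le_rank hκ hc hακ
  obtain ⟨l, hl, hMl, hlκ⟩ := Ordinal.exists_isSuccLimit_between hκ (hr M hM)
  have hrl : (M.rank.toZFSet).rank < l := by rwa [Ordinal.rank_toZFSet]
  have hαl : α.rank < l := hαM.trans_lt hMl
  obtain ⟨ζ, hζ, hζκ, j, hj₁, hj₂⟩ := hext l.toZFSet (ZFSet.isOrdinal_toZFSet l)
    ((hα.1.rank_lt_iff_mem (ZFSet.isOrdinal_toZFSet l)).1 (by rwa [Ordinal.rank_toZFSet]))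
    (by rwa [Ordinal.rank_toZFSet])
  let _ := VStructure l.toZFSet.rank B.toSet
  let _ := VStructure ζ.rank B.toSet
  have hX := isTransModel_vStructure l.toZFSet.rank B.toSet
  have hX' := isTransModel_vStructure ζ.rank B.toSet
  have hlr : l.toZFSet.rank = l := Ordinal.rank_toZFSet l
  let up (x : ZFSet.{u}) (hx : x.rank < l) : {x : ZFSet.{u} // x.rank < l.toZFSet.rank} :=
    ⟨x, by rwa [hlr]⟩
  have hp : (M.pair M.rank.toZFSet).rank < l := rank_pair_lt hl hMl hrl
  have hjp : (j (up _ hp)).1 = (j (up M hMl)).1.pair (j (up _ hrl)).1 :=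
    hX.map_pair hX' j (c := up _ hp) (a := up M hMl) (b := up _ hrl) rfl
  have hjB : (j (up _ hp)).1 ∈ B := (hX.map_pred hX' j).2 ((hB _).2 ⟨M, hM, rfl⟩)
  obtain ⟨N, hN, hNj⟩ := (hB _).1 hjB
  rw [hjp] at hNj
  obtain ⟨hNM, hNr⟩ := ZFSet.pair_inj.1 hNj
  refine ⟨M, hM, N, hN, ?_, ?_⟩
  · intro hMN
    have hle : α = M.rank.toZFSet ∨ α ∈ M.rank.toZFSet := by
      rcases hαM.eq_or_lt with h | h
      · exact Or.inl (by rw [← h, hα.1.toZFSet_rank_eq])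
      · exact Or.inr ((hα.1.rank_lt_iff_mem (ZFSet.isOrdinal_toZFSet _)).1
          (by rwa [Ordinal.rank_toZFSet]))
    obtain ⟨-, hlα⟩ := hj₂ (by rwa [hlr])
    have hr₁ : l < (j (up α hαl)).1.rank := hlr.symm.trans_lt (rank_lt_of_mem hlα)
    have hr₂ : (j (up α hαl)).1.rank ≤ (j (up _ hrl)).1.rank := by
      rcases hle with h | h
      · apply le_of_eq
        congr 3
        exact Subtype.ext h
      · exact (rank_lt_of_mem ((hX.map_mem hX' j (a := up α hαl) (b := up _ hrl)).2 h)).le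
    have hr₃ : (j (up _ hrl)).1.rank = M.rank := by rw [← hNr, Ordinal.rank_toZFSet N.rank, ← hMN]
    exact (hr₁.trans_le (hr₂.trans_eq hr₃)).not_gt hMl
  · obtain ⟨D, E, R, hMe, -, -⟩ := hcode M hM
    have hER : (E.pair R).rank < l := (hMe ▸ rank_snd_lt_rank_pair D _).trans hMl
    have hD : D.rank < l := (hMe ▸ rank_fst_lt_rank_pair D _).trans hMl
    have hE : E.rank < l := (rank_fst_lt_rank_pair E R).trans hER
    have hR : R.rank < l := (rank_snd_lt_rank_pair E R).trans hER
    have h₁ := hX.map_pair hX' j (c := up M hMl) (a := up D hD) (b := up _ hER) hMe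
    have h₂ := hX.map_pair hX' j (c := up _ hER) (a := up E hE) (b := up R hR) rfl
    refine ⟨D, E, R, (j (up D hD)).1, (j (up E hE)).1, (j (up R hR)).1, hMe, ?_, ?_⟩
    · rw [hNM, h₁, h₂]
    · let _ := codedStructure D E R
      let _ := codedStructure (j (up D hD)).1 (j (up E hE)).1 (j (up R hR)).1
      obtain ⟨k, -⟩ := hX.exists_restrict hX' j (D := up D hD) (E := up E hE) (R := up R hR)
        (isCodedBy_codedStructure D E R) (isCodedBy_codedStructure _ _ _)
      exact ⟨k⟩

/-- `s l` is a cofinal sequence in `l` indexed by the ordinals below `(cof l).ord`. -/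
structure IsLadderSystem (s : Ordinal.{u} → Ordinal.{u} → Ordinal.{u}) : Prop where
  lt : ∀ l, ∀ x < l.cof.ord, s l x < l
  cofinal : ∀ l, ∀ a < l, ∃ x < l.cof.ord, a ≤ s l x

theorem exists_isLadderSystem : ∃ s : Ordinal.{u} → Ordinal.{u} → Ordinal.{u},
    IsLadderSystem s := by
  choose g hg using fun l : Ordinal.{u} => Ordinal.exists_isFundamentalSeq (o := l) rfl
  refine ⟨fun l x => if h : x < l.cof.ord then (g l ⟨x, h⟩).1 else 0, fun l x hx => ?_,
    fun l a ha => ?_⟩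
  · simp only [hx, dite_true]
    exact (g l ⟨x, hx⟩).2
  · obtain ⟨_, ⟨x, rfl⟩, hx⟩ := (hg l).isCofinal_range ⟨a, ha⟩
    refine ⟨x.1, x.2, ?_⟩
    simp only [show x.1 < l.cof.ord from x.2, dite_true]
    exact hx

/-- A strictly increasing map on the ordinals below `θ` that commutes with the cofinality function
and with the ladder system `s`. -/
structure IsLadderMap (s : Ordinal.{u} → Ordinal.{u} → Ordinal.{u}) (θ : Ordinal.{u})
    (f : Ordinal.{u} → Ordinal.{u}) : Prop where
  strict : ∀ a b, a < b → b < θ → f a < f b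
  map_zero : f 0 = 0
  map_one : f 1 = 1
  map_omega : f Ordinal.omega0 = Ordinal.omega0
  map_cof : ∀ l < θ, f l.cof.ord = (f l).cof.ord
  map_ladder : ∀ l < θ, ∀ x < l.cof.ord, f (s l x) = s (f l) (f x)

namespace IsLadderMap

variable {s : Ordinal.{u} → Ordinal.{u} → Ordinal.{u}} {θ α : Ordinal.{u}}
  {f : Ordinal.{u} → Ordinal.{u}}

theorem le_map (hf : IsLadderMap s θ f) : ∀ a < θ, a ≤ f a := by
  intro a
  induction a using WellFoundedLT.induction with
  | ind a ih =>
    intro ha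
    refine le_of_forall_lt fun b hb => ?_
    exact (ih b hb (hb.trans ha)).trans_lt (hf.strict b a hb ha)

theorem mono (hf : IsLadderMap s θ f) {a b : Ordinal.{u}} (h : a ≤ b) (hb : b < θ) :
    f a ≤ f b := by
  rcases h.eq_or_lt with rfl | h
  · exact le_rfl
  · exact (hf.strict a b h hb).le

/-- If `(cof l).ord` and its elements are fixed, and the ladder at `l` is mapped below `b`,
then `f l ≤ b`. -/
theorem map_le_of_ladder (hf : IsLadderMap s θ f) (hs : IsLadderSystem s) {l b : Ordinal.{u}}
    (hl : l < θ) (hc : f l.cof.ord = l.cof.ord) (hx : ∀ x < l.cof.ord, f x = x)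
    (hb : ∀ a < l, f a < b) : f l ≤ b := by
  by_contra! h
  obtain ⟨x, hx', hbx⟩ := hs.cofinal (f l) b h
  rw [← hf.map_cof l hl, hc] at hx'
  have h₁ := hf.map_ladder l hl x hx'
  rw [hx x hx'] at h₁
  rw [← h₁] at hbx
  exact (hb _ (hs.lt l x hx')).not_ge hbx

/-- The critical point is equal to its cofinality. -/
theorem ord_cof_eq (hf : IsLadderMap s θ f) (hs : IsLadderSystem s) (hα : α < θ) (hfα : f α ≠ α)
    (hfix : ∀ b < α, f b = b) : α.cof.ord = α := by
  by_contra h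
  have hlt := (Ordinal.ord_cof_le α).lt_of_ne h
  refine hfα (le_antisymm ?_ (hf.le_map α hα))
  refine hf.map_le_of_ladder hs hα (hfix _ hlt) (fun x hx => hfix x (hx.trans hlt)) fun a ha => ?_
  rwa [hfix a ha]

theorem omega_le (hf : IsLadderMap s θ f) (hs : IsLadderSystem s) (hα : α < θ) (hfα : f α ≠ α)
    (hfix : ∀ b < α, f b = b) : Ordinal.omega0 ≤ α := by
  have h := hf.ord_cof_eq hs hα hfα hfix
  have h' : Cardinal.aleph0 ≤ α.cof := by
    by_contra! hlt
    rw [Ordinal.cof_lt_aleph0_iff] at hlt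
    have h₁ : α ≤ 1 := by
      rw [← h, ← Cardinal.ord_one]
      exact Cardinal.ord_le_ord.2 hlt
    rcases h₁.eq_or_lt with rfl | h₀
    · exact hfα hf.map_one
    · rw [Order.lt_one_iff] at h₀
      rw [h₀] at hfα
      exact hfα hf.map_zero
  rw [← h, ← Cardinal.ord_aleph0]
  exact Cardinal.ord_le_ord.2 h'

/-- There is no fixed point above the critical point. -/
theorem map_ne_of_gt (hf : IsLadderMap s θ f) (hs : IsLadderSystem s) (hα : α < θ)
    (hfα : f α ≠ α) (hfix : ∀ b < α, f b = b) {m : Ordinal.{u}} (hm : m < θ) (hαm : α < m) :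
    f m ≠ m := by
  intro hfm
  have hω := hf.omega_le hs hα hfα hfix
  have hlt (n : ℕ) : f^[n] α < m := by
    induction n with
    | zero => exact hαm
    | succ n ih =>
      rw [Function.iterate_succ_apply', ← hfm]
      exact hf.strict _ _ ih hm
  have hstep (n : ℕ) : f^[n] α < f^[n + 1] α := by
    induction n with
    | zero => exact (hf.le_map α hα).lt_of_ne hfα.symm
    | succ n ih =>
      rw [Function.iterate_succ_apply', Function.iterate_succ_apply' f (n + 1)]
      exact hf.strict _ _ ih ((hlt _).trans hm)
  let l := ⨆ n : ℕ, f^[n] α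
  have hle (n : ℕ) : f^[n] α ≤ l := Ordinal.le_iSup (fun n : ℕ => f^[n] α) n
  have hlt' (n : ℕ) : f^[n] α < l := (hstep n).trans_le (hle _)
  have hl : l < θ := (Ordinal.iSup_le fun n => (hlt n).le).trans_lt hm
  have hcof : l.cof.ord ≤ Ordinal.omega0 := by
    by_contra! h
    rw [← Cardinal.ord_aleph0, Cardinal.ord_lt_ord] at h
    have : ⨆ n : ℕ, f^[n] α < l := Ordinal.lift_iSup_lt_of_lt_cof (by simpa using h) hlt'
    exact this.false
  have hfix' (x : Ordinal.{u}) (hx : x < l.cof.ord) : f x = x :=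
    hfix x (hx.trans_le (hcof.trans hω))
  have hcfix : f l.cof.ord = l.cof.ord := by
    rcases hcof.eq_or_lt with h | h
    · rw [h, hf.map_omega]
    · exact hfix _ (h.trans_le hω)
  have hfl : f l = l := by
    refine le_antisymm (hf.map_le_of_ladder hs hl hcfix hfix' fun a ha => ?_) (hf.le_map l hl)
    obtain ⟨n, hn⟩ := Ordinal.lt_iSup_iff.1 ha
    refine (hf.strict _ _ hn ((hlt n).trans hm)).trans_le ?_
    rw [← Function.iterate_succ_apply' f]
    exact hle (n + 1)
  obtain ⟨x, hx, hαx⟩ := hs.cofinal l α (hlt' 0)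
  have hν := hf.map_ladder l hl x hx
  rw [hfl, hfix' x hx] at hν
  have hνl := hs.lt l x hx
  have hbd (n : ℕ) : f^[n] α ≤ s l x := by
    induction n with
    | zero => exact hαx
    | succ n ih =>
      rw [Function.iterate_succ_apply', ← hν]
      exact hf.mono ih (hνl.trans hl)
  exact hνl.not_ge (Ordinal.iSup_le hbd)

end IsLadderMap

/-- The set map underlying an elementary embedding of `⟨V_θ, ∈, P⟩` into `⟨V_θ', ∈, P'⟩`, with the
consequences of elementarity for pairs, for the predicate and for coded substructures. -/
structure IsModelMap (θ θ' : Ordinal.{u}) (P P' : Set ZFSet.{u}) (J : ZFSet.{u} → ZFSet.{u}) :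
    Prop where
  rank_lt : ∀ x, x.rank < θ → (J x).rank < θ'
  map_mem : ∀ x y, x.rank < θ → y.rank < θ → x ∈ y → J x ∈ J y
  map_pred : ∀ x, x.rank < θ → x ∈ P → J x ∈ P'
  map_empty : ∅ ∈ vonNeumann θ → J ∅ = ∅
  map_singleton : ∀ a, ({a} : ZFSet.{u}).rank < θ → J {a} = {J a}
  map_pair : ∀ a b, (a.pair b).rank < θ → J (a.pair b) = (J a).pair (J b)
  restrict : ∀ (η η' : Ordinal.{u}) (A : Set ZFSet.{u}), (vCode η A).rank < θ →
    J (vCode η A) = vCode η' A →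
    letI := VStructure η A
    letI := VStructure η' A
    ∃ k : {x : ZFSet.{u} // x.rank < η} ↪ₑ[LStd] {x : ZFSet.{u} // x.rank < η'},
      ∀ y, (k y).1 = J y.1

theorem ElemEmbeddable.exists_isModelMap {θ θ' : Ordinal.{u}} {P P' : Set ZFSet.{u}}
    (h : ElemEmbeddable (vCode θ P) (vCode θ' P')) : ∃ J, IsModelMap θ θ' P P' J := by
  obtain ⟨M, E, R, N, E', R', h₁, h₂, h⟩ := h
  obtain ⟨rfl, e₁⟩ := ZFSet.pair_inj.1 h₁
  obtain ⟨rfl, rfl⟩ := ZFSet.pair_inj.1 e₁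
  obtain ⟨rfl, e₂⟩ := ZFSet.pair_inj.1 h₂
  obtain ⟨rfl, rfl⟩ := ZFSet.pair_inj.1 e₂
  let _ := codedStructure (vonNeumann θ) (vMem θ) (vPred θ P)
  let _ := codedStructure (vonNeumann θ') (vMem θ') (vPred θ' P')
  obtain ⟨j⟩ : Nonempty (↥(vonNeumann θ).toSet ↪ₑ[LStd] ↥(vonNeumann θ').toSet) := h
  have hX := isTransModel_vCode θ P
  have hX' := isTransModel_vCode θ' P'
  let up (x : ZFSet.{u}) (hx : x.rank < θ) : ↥(vonNeumann θ).toSet := ⟨x, mem_vonNeumann.2 hx⟩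
  let J (x : ZFSet.{u}) : ZFSet.{u} := if hx : x.rank < θ then (j (up x hx)).1 else ∅
  have hJ (x : ZFSet.{u}) (hx : x.rank < θ) : J x = (j (up x hx)).1 := dif_pos hx
  refine ⟨J, ?_, ?_, ?_, ?_, ?_, ?_, ?_⟩
  · intro x hx
    rw [hJ x hx]
    exact mem_vonNeumann.1 (j (up x hx)).2
  · intro x y hx hy h
    rw [hJ x hx, hJ y hy]
    exact (hX.map_mem hX' j).2 h
  · intro x hx h
    rw [hJ x hx]
    exact (hX.map_pred hX' j).2 h
  · intro h
    rw [hJ ∅ (mem_vonNeumann.1 h)]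
    exact hX.map_empty hX' j rfl
  · intro a h
    have ha : a.rank < θ := (rank_lt_of_mem (mem_singleton.2 rfl)).trans h
    rw [hJ _ h, hJ a ha]
    refine Eq.trans ?_ (pair_eq_singleton _)
    exact hX.map_upair hX' j (c := up _ h) (a := up a ha) (b := up a ha) (pair_eq_singleton a).symm
  · intro a b h
    have ha : a.rank < θ := (rank_fst_lt_rank_pair a b).trans h
    have hb : b.rank < θ := (rank_snd_lt_rank_pair a b).trans h
    rw [hJ _ h, hJ a ha, hJ b hb]
    exact hX.map_pair hX' j (c := up _ h) (a := up a ha) (b := up b hb) rfl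
  · intro η η' A h h'
    have hER : ((vMem η).pair (vPred η A)).rank < θ := (rank_snd_lt_rank_pair _ _).trans h
    have hD : (vonNeumann η).rank < θ := (rank_fst_lt_rank_pair _ _).trans h
    have hE : (vMem η).rank < θ := (rank_fst_lt_rank_pair _ _).trans hER
    have hR : (vPred η A).rank < θ := (rank_snd_lt_rank_pair _ _).trans hER
    have h₁ := hX.map_pair hX' j (c := up _ h) (a := up _ hD) (b := up _ hER) rfl
    have h₂ := hX.map_pair hX' j (c := up _ hER) (a := up _ hE) (b := up _ hR) rfl
    rw [hJ _ h, h₁, h₂] at h'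
    obtain ⟨eD, h'⟩ := ZFSet.pair_inj.1 h'
    obtain ⟨eE, eR⟩ := ZFSet.pair_inj.1 h'
    let _ := VStructure η A
    let _ := VStructure η' A
    obtain ⟨k, hk⟩ := hX.exists_restrict hX' j (D := up _ hD) (E := up _ hE) (R := up _ hR)
      (isCodedBy_vStructure η A) (by rw [eD, eE, eR]; exact isCodedBy_vStructure η' A)
    refine ⟨k, fun y => ?_⟩
    have hy : y.1.rank < θ := y.2.trans (by rwa [rank_vonNeumann] at hD)
    rw [hJ _ hy]
    exact hk y (up _ hy) rfl

/-- The Zermelo numerals. -/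
noncomputable def ZFSet.numeral : ℕ → ZFSet.{u}
  | 0 => ∅
  | n + 1 => {numeral n}

theorem ZFSet.numeral_injective : Function.Injective numeral.{u} := by
  have hne (n : ℕ) : numeral.{u} (n + 1) ≠ numeral 0 := fun h =>
    notMem_empty (numeral n) (h ▸ mem_singleton.2 rfl : numeral n ∈ numeral 0)
  intro m
  induction m with
  | zero =>
    rintro (_ | n) h
    · rfl
    · exact absurd h.symm (hne n)
  | succ m ih =>
    rintro (_ | n) h
    · exact absurd h (hne m)
    · rw [ih (singleton_injective h)]

theorem ZFSet.rank_numeral_lt {θ : Ordinal.{u}} (hθ : Order.IsSuccLimit θ) (n : ℕ) :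
    (numeral.{u} n).rank < θ := by
  induction n with
  | zero =>
    rw [numeral, rank_empty]
    exact hθ.bot_lt
  | succ n ih =>
    rw [numeral, rank_singleton]
    exact hθ.succ_lt ih

theorem IsModelMap.map_numeral {θ θ' : Ordinal.{u}} {P P' : Set ZFSet.{u}}
    {J : ZFSet.{u} → ZFSet.{u}} (hJ : IsModelMap θ θ' P P' J) (hθ : Order.IsSuccLimit θ) (n : ℕ) :
    J (numeral n) = numeral n := by
  induction n with
  | zero => exact hJ.map_empty (mem_vonNeumann.2 (rank_numeral_lt hθ 0))
  | succ n ih => rw [numeral, hJ.map_singleton _ (rank_numeral_lt hθ (n + 1)), ih]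

section Family

variable (F : Ordinal.{u} → Ordinal.{u}) (s : Ordinal.{u} → Ordinal.{u} → Ordinal.{u})
  (A : Set ZFSet.{u}) (γ : Ordinal.{u})

/-- The relations recorded by the predicate of the structure attached to `γ`: the point `γ`, the
ordinals, the graph of `F` together with the structures `⟨V_{F o}, ∈, A⟩`, the closure points of
`F`, the ladder system `s`, the cofinality function, and the ordinal `ω`. -/
def recorded : ℕ → Set ZFSet.{u}
  | 0 => {γ.toZFSet}
  | 1 => Set.range Ordinal.toZFSet
  | 2 => Set.range fun o : Ordinal.{u} => o.toZFSet.pair ((F o).toZFSet.pair (vCode (F o) A))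
  | 3 => Ordinal.toZFSet '' {o | ∀ b < o, F b < o}
  | 4 => Set.range fun p : Ordinal.{u} × Ordinal.{u} =>
      p.1.toZFSet.pair (p.2.toZFSet.pair (s p.1 p.2).toZFSet)
  | 5 => Set.range fun o : Ordinal.{u} => o.toZFSet.pair o.cof.ord.toZFSet
  | 6 => {Ordinal.omega0.toZFSet}
  | _ => ∅

/-- The disjoint union of the sets `recorded F s A γ i`. -/
def recordedSum : Set ZFSet.{u} :=
  {x | ∃ i, ∃ p ∈ recorded F s A γ i, x = (numeral i).pair p}

variable {F s A γ}

theorem pair_mem_recordedSum {i : ℕ} {p : ZFSet.{u}} :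
    (numeral i).pair p ∈ recordedSum F s A γ ↔ p ∈ recorded F s A γ i := by
  refine ⟨?_, fun h => ⟨i, p, h, rfl⟩⟩
  rintro ⟨i', p', hp, h⟩
  obtain ⟨h₁, rfl⟩ := ZFSet.pair_inj.1 h
  rwa [numeral_injective h₁]

variable {θ θ' δ : Ordinal.{u}} {J : ZFSet.{u} → ZFSet.{u}}

theorem IsModelMap.map_recorded
    (hJ : IsModelMap θ θ' (recordedSum F s A γ) (recordedSum F s A δ) J)
    (hθ : Order.IsSuccLimit θ) {i : ℕ} {p : ZFSet.{u}} (hp : p.rank < θ)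
    (h : p ∈ recorded F s A γ i) : J p ∈ recorded F s A δ i := by
  have hr := rank_pair_lt hθ (rank_numeral_lt hθ i) hp
  have := hJ.map_pred _ hr (pair_mem_recordedSum.2 h)
  rwa [hJ.map_pair _ _ hr, hJ.map_numeral hθ, pair_mem_recordedSum] at this

theorem IsModelMap.map_toZFSet
    (hJ : IsModelMap θ θ' (recordedSum F s A γ) (recordedSum F s A δ) J)
    (hθ : Order.IsSuccLimit θ) {o : Ordinal.{u}} (ho : o < θ) :
    J o.toZFSet = (J o.toZFSet).rank.toZFSet := by
  obtain ⟨o', h⟩ : J o.toZFSet ∈ Set.range Ordinal.toZFSet :=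
    hJ.map_recorded hθ (i := 1) (by rwa [Ordinal.rank_toZFSet]) ⟨o, rfl⟩
  rw [← h, Ordinal.rank_toZFSet]

theorem IsModelMap.isLadderMap
    (hJ : IsModelMap θ θ' (recordedSum F s A γ) (recordedSum F s A δ) J)
    (hs : IsLadderSystem s) (hθ : Order.IsSuccLimit θ) (hω : Ordinal.omega0 < θ) :
    IsLadderMap s θ fun o => (J o.toZFSet).rank := by
  have hr {o : Ordinal.{u}} (ho : o < θ) : o.toZFSet.rank < θ := by rwa [Ordinal.rank_toZFSet]
  refine ⟨fun a b hab hb => ?_, ?_, ?_, ?_, fun l hl => ?_, fun l hl x hx => ?_⟩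
  · exact rank_lt_of_mem (hJ.map_mem _ _ (hr (hab.trans hb)) (hr hb)
      (Ordinal.toZFSet_mem_toZFSet_iff.2 hab))
  · have := hJ.map_numeral hθ 0
    rw [numeral] at this
    simp only [Ordinal.toZFSet_zero, this, rank_empty]
  · have := hJ.map_numeral hθ 1
    rw [numeral, numeral] at this
    have h₁ : (1 : Ordinal.{u}).toZFSet = {∅} := by
      rw [← zero_add (1 : Ordinal.{u}), Ordinal.toZFSet_add_one, Ordinal.toZFSet_zero]
      rfl
    simp only [h₁, this]
    rw [← h₁, Ordinal.rank_toZFSet]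
  · have h : J Ordinal.omega0.toZFSet = Ordinal.omega0.toZFSet :=
      hJ.map_recorded hθ (i := 6) (hr hω) rfl
    simp only [h, Ordinal.rank_toZFSet]
  · have hc := hr ((Ordinal.ord_cof_le l).trans_lt hl)
    have hp := rank_pair_lt hθ (hr hl) hc
    obtain ⟨l', h⟩ := hJ.map_recorded hθ (i := 5) hp ⟨l, rfl⟩
    rw [hJ.map_pair _ _ hp] at h
    obtain ⟨h₁, h₂⟩ := ZFSet.pair_inj.1 h
    simp only [← h₁, ← h₂, Ordinal.rank_toZFSet]
  · have hxθ := hr (hx.trans_le (Ordinal.ord_cof_le l) |>.trans hl)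
    have hsl := hr ((hs.lt l x hx).trans hl)
    have hp := rank_pair_lt hθ (hr hl) (rank_pair_lt hθ hxθ hsl)
    obtain ⟨⟨l', x'⟩, h⟩ := hJ.map_recorded hθ (i := 4) hp ⟨(l, x), rfl⟩
    rw [hJ.map_pair _ _ hp, hJ.map_pair _ _ (rank_pair_lt hθ hxθ hsl)] at h
    obtain ⟨h₁, h⟩ := ZFSet.pair_inj.1 h
    obtain ⟨h₂, h₃⟩ := ZFSet.pair_inj.1 h
    simp only [← h₁, ← h₂, ← h₃, Ordinal.rank_toZFSet]

theorem IsModelMap.map_graph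
    (hJ : IsModelMap θ θ' (recordedSum F s A γ) (recordedSum F s A δ) J)
    (hθ : Order.IsSuccLimit θ) {o : Ordinal.{u}} (ho : o < θ) (hFo : F o < θ) :
    (J (F o).toZFSet).rank = F (J o.toZFSet).rank ∧
      J (vCode (F o) A) = vCode (F (J o.toZFSet).rank) A := by
  have hr {o : Ordinal.{u}} (ho : o < θ) : o.toZFSet.rank < θ := by rwa [Ordinal.rank_toZFSet]
  have hq := rank_pair_lt hθ (hr hFo) (rank_vCode_lt A hθ hFo)
  have hp := rank_pair_lt hθ (hr ho) hq
  obtain ⟨o', h⟩ := hJ.map_recorded hθ (i := 2) hp ⟨o, rfl⟩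
  rw [hJ.map_pair _ _ hp, hJ.map_pair _ _ hq] at h
  obtain ⟨h₁, h⟩ := ZFSet.pair_inj.1 h
  obtain ⟨h₂, h₃⟩ := ZFSet.pair_inj.1 h
  rw [← h₁, ← h₂, ← h₃, Ordinal.rank_toZFSet, Ordinal.rank_toZFSet]
  exact ⟨rfl, rfl⟩

/-- The critical point of an elementary embedding between members of the family is a cardinal
`α ≤ γ` for which the embedding restricts to a witness of `F α`-extendibility. -/
theorem IsModelMap.exists_extWitness
    (hJ : IsModelMap θ θ' (recordedSum F s A γ) (recordedSum F s A δ) J) (hγδ : γ ≠ δ)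
    (hs : IsLadderSystem s) (hθ : Order.IsSuccLimit θ) (hω : Ordinal.omega0 < θ) (hγ : γ < θ)
    (hF : ∀ b ≤ γ, F b < θ) :
    ∃ α ≤ γ, ZFIsCardinal α.toZFSet ∧ ∃ ζ < θ', ExtWitness A α.toZFSet (F α).toZFSet ζ.toZFSet := by
  have hr {o : Ordinal.{u}} (ho : o < θ) : o.toZFSet.rank < θ := by rwa [Ordinal.rank_toZFSet]
  have hf := hJ.isLadderMap hs hθ hω
  have hJo {o : Ordinal.{u}} (ho : o < θ) := hJ.map_toZFSet hθ ho
  have hgraph {o : Ordinal.{u}} (ho : o ≤ γ) := hJ.map_graph hθ (ho.trans_lt hγ) (hF o ho)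
  set f : Ordinal.{u} → Ordinal.{u} := fun o => (J o.toZFSet).rank with hfdef
  have hfγ : f γ ≠ γ := by
    have h : J γ.toZFSet = δ.toZFSet := hJ.map_recorded hθ (i := 0) (hr hγ) rfl
    simp only [hfdef, h, Ordinal.rank_toZFSet]
    exact hγδ.symm
  obtain ⟨α, hfα, hmin⟩ : ∃ α, f α ≠ α ∧ ∀ b < α, f b = b :=
    ⟨sInf {o | f o ≠ o}, csInf_mem (s := {o | f o ≠ o}) ⟨γ, hfγ⟩,
      fun b hb => not_not.1 (notMem_of_lt_csInf' hb)⟩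
  have hαγ : α ≤ γ := not_lt.1 fun h => hfγ (hmin γ h)
  have hα : α < θ := hαγ.trans_lt hγ
  have hcof := hf.ord_cof_eq hs hα hfα hmin
  have hαlt : α < f α := (hf.le_map α hα).lt_of_ne hfα.symm
  have hclosed (b : Ordinal.{u}) (hb : b < α) : F b < α := by
    by_contra! h
    have hbγ := hb.le.trans hαγ
    have hfix : f (F b) = F b := (hgraph hbγ).1.trans (congrArg F (hmin b hb))
    rcases h.eq_or_lt with h | h
    · rw [← h] at hfix
      exact hfα hfix
    · exact hf.map_ne_of_gt hs hα hfα hmin (hF b hbγ) h hfix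
  have hclosed' : F α < f α := by
    obtain ⟨o, ho, h⟩ := hJ.map_recorded hθ (i := 3) (hr hα) ⟨α, hclosed, rfl⟩
    rw [hJo hα] at h
    obtain rfl := Ordinal.toZFSet_injective h
    exact ho α hαlt
  refine ⟨α, hαγ, ⟨isOrdinal_toZFSet α, ?_⟩, F (f α), ?_, ?_⟩
  · intro β hβ
    obtain ⟨b, hb, rfl⟩ := Ordinal.mem_toZFSet_iff.1 hβ
    have hlt : b.card < α.card :=
      (Cardinal.lt_ord.1 (hb.trans_eq hcof.symm)).trans_le (Ordinal.cof_le_card α)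
    rw [← Ordinal.card_toZFSet b, ← Ordinal.card_toZFSet α, ← Cardinal.lift_lt.{u, u + 1},
      ← cardinalMk_coe_sort, ← cardinalMk_coe_sort] at hlt
    exact hlt
  · rw [← (hgraph hαγ).1]
    exact hJ.rank_lt _ (hr (hF α hαγ))
  · obtain ⟨k, hk⟩ := hJ.restrict (F α).toZFSet.rank (F (f α)).toZFSet.rank A
      (by rw [Ordinal.rank_toZFSet]; exact rank_vCode_lt A hθ (hF α hαγ))
      (by rw [Ordinal.rank_toZFSet, Ordinal.rank_toZFSet]; exact (hgraph hαγ).2)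
    refine ⟨k, fun β hβ hβα => ?_, fun h => ?_⟩
    · obtain ⟨b, hb, rfl⟩ := Ordinal.mem_toZFSet_iff.1 hβα
      rw [hk, hJo (hb.trans hα)]
      exact congrArg Ordinal.toZFSet (hmin b hb)
    · rw [hk, hJo hα]
      exact ⟨fun h => hfα (Ordinal.toZFSet_injective h),
        Ordinal.toZFSet_mem_toZFSet_iff.2 hclosed'⟩

end Family

theorem exists_isSuccLimit_bound {κ : Cardinal.{u}} (hκ : κ.IsInaccessible)
    {F : Ordinal.{u} → Ordinal.{u}} (hF : ∀ o < κ.ord, F o < κ.ord) {γ : Ordinal.{u}}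
    (hγ : γ < κ.ord) :
    ∃ θ < κ.ord, Order.IsSuccLimit θ ∧ Ordinal.omega0 < θ ∧ γ < θ ∧ ∀ b ≤ γ, F b < θ := by
  have hω : Ordinal.omega0 < κ.ord := by
    rw [← Cardinal.ord_aleph0]
    exact Cardinal.ord_lt_ord.2 hκ.aleph0_lt
  have hγ' := (Cardinal.isSuccLimit_ord hκ.aleph0_lt.le).succ_lt hγ
  have hsup : ⨆ b : Set.Iio (Order.succ γ), F b.1 < κ.ord := by
    refine Ordinal.lift_iSup_lt_of_lt_cof ?_ fun b => hF _ (lt_trans b.2 hγ')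
    rw [Cardinal.mk_Iio_ordinal, ← Ordinal.lift_cof, hκ.isRegular.cof_ord]
    rw [Cardinal.lift_umax.{u, u + 1}, Cardinal.lift_id'.{u, u + 1}, Cardinal.lift_lt]
    exact Cardinal.lt_ord.1 hγ'
  obtain ⟨θ, hθ, hlt, hθκ⟩ :=
    Ordinal.exists_isSuccLimit_between hκ (max_lt (max_lt hω hγ) hsup)
  refine ⟨θ, hθκ, hθ, ?_, ?_, fun b hb => ?_⟩
  · exact ((le_max_left _ _).trans (le_max_left _ _)).trans_lt hlt
  · exact ((le_max_right _ _).trans (le_max_left _ _)).trans_lt hlt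
  · refine lt_of_le_of_lt ?_ ((le_max_right _ _).trans_lt hlt)
    exact Ordinal.le_iSup (fun b : Set.Iio (Order.succ γ) => F b.1) ⟨b, Order.lt_succ_of_le hb⟩

theorem IsVopenka.exists_extendibleBelow {κ : Cardinal.{u}} (hκ : IsVopenka κ)
    (A : Set ZFSet.{u}) :
    ∃ α : ZFSet.{u}, ZFIsCardinal α ∧ α.rank < κ.ord ∧ ExtendibleBelow κ A α := by
  obtain ⟨hκ, hVP⟩ := hκ
  by_contra! hne
  have hlim : Order.IsSuccLimit κ.ord := Cardinal.isSuccLimit_ord hκ.aleph0_lt.le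
  have hF (o : Ordinal.{u}) : ∃ e : Ordinal.{u}, o < κ.ord → e < κ.ord ∧
      (ZFIsCardinal o.toZFSet → ¬EtaExtendibleBelow κ A o.toZFSet e.toZFSet) := by
    by_cases h : o < κ.ord ∧ ZFIsCardinal o.toZFSet
    · have := hne _ h.2 (by rw [Ordinal.rank_toZFSet]; exact h.1)
      rw [ExtendibleBelow] at this
      push Not at this
      obtain ⟨η, hη, -, hηκ, hn⟩ := this
      exact ⟨η.rank, fun _ => ⟨hηκ, fun _ => by rwa [hη.toZFSet_rank_eq]⟩⟩
    · exact ⟨0, fun ho => ⟨hlim.bot_lt, fun hc => absurd ⟨ho, hc⟩ h⟩⟩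
  choose F hF using hF
  obtain ⟨s, hs⟩ := exists_isLadderSystem.{u}
  choose θ hθκ hθ hω hγθ hFθ using fun γ : Set.Iio κ.ord =>
    exists_isSuccLimit_bound hκ (fun o ho => (hF o ho).1) γ.2
  let S (γ : Set.Iio κ.ord) : ZFSet.{u} := vCode (θ γ) (recordedSum F s A γ)
  have hSinj : Function.Injective S := by
    intro γ δ h
    obtain ⟨-, h₁⟩ := ZFSet.pair_inj.1 h
    obtain ⟨-, h₂⟩ := ZFSet.pair_inj.1 h₁
    have hγ : (numeral 0).pair γ.1.toZFSet ∈ vPred (θ γ) (recordedSum F s A γ) :=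
      mem_vPred.2 ⟨rank_pair_lt (hθ γ) (rank_numeral_lt (hθ γ) 0)
        (by rw [Ordinal.rank_toZFSet]; exact hγθ γ), pair_mem_recordedSum.2 rfl⟩
    rw [h₂] at hγ
    have : γ.1.toZFSet = δ.1.toZFSet := pair_mem_recordedSum.1 (mem_vPred.1 hγ).2
    exact Subtype.ext (Ordinal.toZFSet_injective this)
  have hmem {x : ZFSet.{u}} : x ∈ ZFSet.range S ↔ ∃ γ, S γ = x := ZFSet.mem_range
  obtain ⟨M, hM, N, hN, hMN, hemb⟩ := hVP (ZFSet.range S) (fun x hx => by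
      obtain ⟨γ, rfl⟩ := hmem.1 hx
      exact rank_vCode_lt _ hlim (hθκ γ)) (by
      have hS : (ZFSet.range S).toSet = Set.range S := Set.ext fun x => hmem
      rw [hS, Cardinal.mk_range_eq _ hSinj, Cardinal.mk_Iio_ordinal, Cardinal.card_ord]) (by
      intro x hx
      obtain ⟨γ, rfl⟩ := hmem.1 hx
      exact isLStdCode_vCode _ _)
  obtain ⟨γ, rfl⟩ := hmem.1 hM
  obtain ⟨δ, rfl⟩ := hmem.1 hN
  obtain ⟨J, hJ⟩ := hemb.exists_isModelMap
  obtain ⟨α, hαγ, hα, ζ, hζ, h⟩ := hJ.exists_extWitness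
    (fun h => hMN (congrArg S (Subtype.ext h))) hs (hθ γ) (hω γ) (hγθ γ) (hFθ γ)
  refine (hF α (lt_of_le_of_lt hαγ γ.2)).2 hα ⟨ζ.toZFSet, isOrdinal_toZFSet ζ, ?_, h⟩
  rw [Ordinal.rank_toZFSet]
  exact hζ.trans (hθκ δ)

/-- Proposition 7 (`VopCardExtA`): for an inaccessible cardinal `κ`, the following are
equivalent: (1) `κ` is a Vopěnka cardinal; (2) for every set `A ⊆ V_κ` there is a cardinal
`α < κ` that is extendible below `κ` for `A`. -/
theorem isVopenka_iff_extendibleBelow (κ : Cardinal.{u}) (hκ : κ.IsInaccessible) :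
    IsVopenka κ ↔
      ∀ A : ZFSet.{u}, (∀ x ∈ A, x.rank < κ.ord) →
        ∃ α : ZFSet.{u}, ZFIsCardinal α ∧ α.rank < κ.ord ∧ ExtendibleBelow κ A.toSet α := by
  exact ⟨fun h A _ => h.exists_extendibleBelow A.toSet, isVopenka_of_extendibleBelow hκ⟩
end

section
/- If κ is a Vopěnka cardinal, then for every set A ⊆ V_κ there is a cardinal α < κ that is extendible below κ for A, i.e., for every η with α < η < κ there exist ζ < κ and an elementary embedding j : ⟨V_η, ∈, A ∩ V_η⟩ → ⟨V_ζ, ∈, A ∩ V_ζ⟩ with critical point α and j(α) > η. -/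
open FirstOrder

universe u

universe v

open Cardinal FirstOrder.Language

theorem exists_injective_transversal {I X : Type v} (F : I → Set X) (hF : ∀ i, #I ≤ #(F i)) :
    ∃ c : I → X, Function.Injective c ∧ ∀ i, c i ∈ F i := by
  obtain ⟨r, wo, hr⟩ := exists_ord_eq I
  have step : ∀ i (p : ∀ k, r k i → X), ∃ x ∈ F i, ∀ k (hk : r k i), p k hk ≠ x := by
    intro i p
    by_contra! hcon
    have hsub : F i ⊆ Set.range fun k : {k // r k i} => p k.1 k.2 := by
      intro x hx
      obtain ⟨k, hk, e⟩ := hcon x hx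
      exact ⟨⟨k, hk⟩, e⟩
    have hlt : #{k // r k i} < #I := by
      have := Ordinal.typein_lt_type r i
      rw [← hr, lt_ord, Ordinal.card_typein] at this
      exact this
    exact absurd ((mk_le_mk_of_subset hsub).trans mk_range_le) (hlt.trans_le (hF i)).not_ge
  choose g hgF hg using step
  let c : I → X := wo.wf.fix g
  have hc : ∀ i, c i = g i fun k _ => c k := fun i => wo.wf.fix_eq g i
  have hne : ∀ {k i}, r k i → c k ≠ c i := fun {k i} hk e =>
    hg i (fun k _ => c k) k hk (e.trans (hc i))
  refine ⟨c, fun i k e => ?_, fun i => by rw [hc]; exact hgF _ _⟩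
  rcases trichotomous_of r i k with h | h | h
  · exact (hne h e).elim
  · exact h
  · exact (hne h e.symm).elim

namespace ZFSet

theorem rank_kuratowski_pair (x y : ZFSet.{u}) : (pair x y).rank = max x.rank y.rank + 2 := by
  have h : Order.succ x.rank ≤ max (Order.succ x.rank) (Order.succ y.rank) := le_max_left _ _
  rw [pair, rank_pair, rank_singleton, rank_pair, max_eq_right (Order.succ_le_succ h),
    ← (Order.succ_mono (α := Ordinal)).map_max, Order.succ_eq_add_one,
    Order.succ_eq_add_one, add_assoc, one_add_one_eq_two]

end ZFSet

/-- The `ω`-ary operations on the sets of rank less than `τ`. -/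
abbrev OmegaOp (τ : Ordinal.{u}) : Type (u + 1) :=
  (ℕ → {x : ZFSet.{u} // x.rank < τ}) → {x : ZFSet.{u} // x.rank < τ}

/-- An `ω`-ary operation is Jónsson if every element is a value of it at a sequence in the range
of `h`, for every injective self-map `h`. -/
def OmegaOp.IsJonsson {τ : Ordinal.{u}} (f : OmegaOp τ) : Prop :=
  ∀ h : {x : ZFSet.{u} // x.rank < τ} → {x : ZFSet.{u} // x.rank < τ}, Function.Injective h →
    ∀ y, ∃ σ : ℕ → {x : ZFSet.{u} // x.rank < τ}, f (fun n => h (σ n)) = y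

theorem OmegaOp.exists_isJonsson {τ : Ordinal.{u}} (s : ℕ → Ordinal.{u}) (hs : ∀ n, s n < τ)
    (hcof : ∀ x < τ, ∃ n, x < s n) : ∃ f : OmegaOp τ, f.IsJonsson := by
  set U := {x : ZFSet.{u} // x.rank < τ}
  have hsucc : ∀ x < τ, x + 1 < τ := fun x hx => by
    obtain ⟨n, hn⟩ := hcof x hx
    exact (Order.add_one_le_of_lt hn).trans_lt (hs n)
  have hpair : ∀ x y : U, (ZFSet.pair x.1 y.1).rank < τ := fun x y => by
    rw [ZFSet.rank_kuratowski_pair, ← one_add_one_eq_two, ← add_assoc]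
    exact hsucc _ (hsucc _ (max_lt x.2 y.2))
  let g : (U → U) → ℕ → U := fun h n =>
    ⟨(ZFSet.vonNeumann (s n)).sep fun p => ∃ x : U, p = ZFSet.pair x.1 (h x).1, by
      refine (ZFSet.rank_mono ZFSet.sep_subset).trans_lt ?_
      rw [ZFSet.rank_vonNeumann]
      exact hs n⟩
  have hgm : ∀ h n p, p ∈ (g h n).1 ↔
      p ∈ ZFSet.vonNeumann (s n) ∧ ∃ x : U, p = ZFSet.pair x.1 (h x).1 :=
    fun h n p => ZFSet.mem_sep (p := fun p => ∃ x : U, p = ZFSet.pair x.1 (h x).1)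
  have hg : Function.Injective g := by
    intro h k e
    funext x
    obtain ⟨n, hn⟩ := hcof _ (hpair x (h x))
    have hm : ZFSet.pair x.1 (h x).1 ∈ (g h n).1 :=
      (hgm h n _).2 ⟨ZFSet.mem_vonNeumann.2 hn, x, rfl⟩
    rw [e] at hm
    obtain ⟨-, z, hz⟩ := (hgm k n _).1 hm
    obtain ⟨h1, h2⟩ := ZFSet.pair_inj.1 hz
    obtain rfl := Subtype.ext h1
    exact Subtype.ext h2
  have hcard : #({h : U → U // Function.Injective h} × U) ≤ #(ℕ → U) := by
    refine mk_le_of_injective (f := fun i n => n.casesOn i.2 (g i.1.1)) ?_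
    intro i k e
    exact Prod.ext (Subtype.ext (hg (funext fun n => congrFun e (n + 1)))) (congrFun e 0)
  obtain ⟨c, hc, hcF⟩ := exists_injective_transversal
    (fun i : {h : U → U // Function.Injective h} × U =>
      Set.range fun (σ : ℕ → U) n => i.1.1 (σ n)) (fun i => hcard.trans (by
        rw [mk_range_eq]
        exact fun σ σ' e => funext fun n => i.1.2 (congrFun e n)))
  classical
  refine ⟨fun σ => if h : ∃ i, c i = σ then h.choose.2 else σ 0, fun h hh y => ?_⟩
  let i₀ : {h : U → U // Function.Injective h} × U := (⟨h, hh⟩, y)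
  obtain ⟨σ, hσ⟩ := hcF i₀
  refine ⟨σ, ?_⟩
  have hex : ∃ i, c i = fun n => h (σ n) := ⟨_, hσ.symm⟩
  have heq : hex.choose = i₀ := hc (hex.choose_spec.trans hσ)
  exact (dif_pos hex).trans (congrArg Prod.snd heq)

/-- The binary relation symbol of `L_std`. -/
def epsSymb : LStd.Relations 2 := LStdRel.eps

/-- The unary relation symbol of `L_std`. -/
def rSymb : LStd.Relations 1 := LStdRel.r

/-- The sets of rank less than `γ`, to be viewed as the `L_std`-structure in which `R` is `A`
and `ε` is membership together with the loops at the elements of `B`. -/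
def MarkedRank (_A _B : Set ZFSet.{u}) (γ : Ordinal.{u}) : Type (u + 1) :=
  {x : ZFSet.{u} // x.rank < γ}

namespace MarkedRank

variable {A B B' : Set ZFSet.{u}} {γ γ' η : Ordinal.{u}}

instance : LStd.Structure (MarkedRank A B γ) where
  funMap := fun f _ => f.elim
  RelMap
    | .eps, x => (x 0).1 ∈ (x 1).1 ∨ (x 0 = x 1 ∧ (x 0).1 ∈ B)
    | .r, x => (x 0).1 ∈ A

theorem relMap_eps (x : Fin 2 → MarkedRank A B γ) :
    Structure.RelMap epsSymb x ↔
      (x 0).1 ∈ (x 1).1 ∨ (x 0 = x 1 ∧ (x 0).1 ∈ B) := Iff.rfl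

theorem relMap_r (x : Fin 1 → MarkedRank A B γ) :
    Structure.RelMap rSymb x ↔ (x 0).1 ∈ A := Iff.rfl

/-- The formula expressing proper membership in a marked rank. -/
def memFormula {α : Type*} {n : ℕ} (s t : LStd.Term (α ⊕ Fin n)) : LStd.BoundedFormula α n :=
  (Relations.boundedFormula₂ epsSymb s t) ⊓ ∼(s =' t)

theorem realize_memFormula {α : Type*} {n : ℕ} (s t : LStd.Term (α ⊕ Fin n))
    (v : α → MarkedRank A B γ) (xs : Fin n → MarkedRank A B γ) :
    (memFormula s t).Realize v xs ↔
      (s.realize (Sum.elim v xs)).1 ∈ (t.realize (Sum.elim v xs)).1 := by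
  rw [memFormula, BoundedFormula.realize_inf, BoundedFormula.realize_rel₂, relMap_eps,
    BoundedFormula.realize_not, BoundedFormula.realize_bdEqual]
  simp only [Matrix.cons_val_zero, Matrix.cons_val_one]
  constructor
  · rintro ⟨h | h, hne⟩
    · exact h
    · exact absurd h.1 hne
  · intro h
    refine ⟨Or.inl h, fun e => ?_⟩
    rw [e] at h
    exact ZFSet.mem_irrefl _ h

/-- The formula expressing that a set is empty. -/
def emptyFormula : LStd.Formula (Fin 1) :=
  ∀' ∼(memFormula (&0) (Term.var (Sum.inl 0)))

theorem realize_emptyFormula (v : Fin 1 → MarkedRank A B γ) :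
    emptyFormula.Realize v ↔ (v 0).1 = ∅ := by
  simp only [emptyFormula, Formula.Realize, BoundedFormula.realize_all,
    BoundedFormula.realize_not, realize_memFormula, Term.realize_var, Sum.elim_inl]
  rw [ZFSet.eq_empty]
  constructor
  · intro h y hy
    exact h ⟨y, (ZFSet.rank_lt_of_mem hy).trans (v 0).2⟩ hy
  · intro h a
    exact h a.1

/-- The formula expressing that the first set is the unordered pair of the other two. -/
def upairFormula : LStd.Formula (Fin 3) :=
  ∀' ((memFormula (&0) (Term.var (Sum.inl 0))).iff
    (((&0) =' (Term.var (Sum.inl 1))) ⊔ ((&0) =' (Term.var (Sum.inl 2)))))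

theorem realize_upairFormula (v : Fin 3 → MarkedRank A B γ) :
    upairFormula.Realize v ↔ (v 0).1 = {(v 1).1, (v 2).1} := by
  simp only [upairFormula, Formula.Realize, BoundedFormula.realize_all, BoundedFormula.realize_iff,
    BoundedFormula.realize_sup, BoundedFormula.realize_bdEqual, realize_memFormula,
    Term.realize_var, Sum.elim_inl]
  constructor
  · intro h
    ext z
    rw [ZFSet.mem_pair]
    constructor
    · intro hz
      have := (h ⟨z, (ZFSet.rank_lt_of_mem hz).trans (v 0).2⟩).1 hz
      exact this.imp (congrArg Subtype.val) (congrArg Subtype.val)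
    · rintro (rfl | rfl)
      · exact (h (v 1)).2 (Or.inl rfl)
      · exact (h (v 2)).2 (Or.inr rfl)
  · intro h a
    change a.1 ∈ (v 0).1 ↔ _
    rw [h, ZFSet.mem_pair]
    exact or_congr Subtype.ext_iff.symm Subtype.ext_iff.symm

/-- The interpretation of the relation symbols in the relativization of a formula. -/
def relativizeRel {α : Type*} {n : ℕ} : ∀ {l : ℕ}, LStdRel l →
    (Fin l → LStd.Term (α ⊕ Fin n)) → LStd.BoundedFormula α n
  | _, .eps, ts => memFormula (ts 0) (ts 1)
  | _, .r, ts => Relations.boundedFormula₁ rSymb (ts 0)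

/-- The relativization of a formula to the set denoted by the extra free variable `none`. -/
def relativize {α : Type*} : ∀ {n : ℕ}, LStd.BoundedFormula α n →
    LStd.BoundedFormula (Option α) n
  | _, .falsum => .falsum
  | _, .equal s t => (s.relabel (Sum.map some id)) =' (t.relabel (Sum.map some id))
  | _, .rel R ts => relativizeRel R fun i => (ts i).relabel (Sum.map some id)
  | _, .imp φ ψ => (relativize φ).imp (relativize ψ)
  | n, .all φ => .all <|
    (memFormula (Term.var (Sum.inr (Fin.last n))) (Term.var (Sum.inl none))).imp (relativize φ)

/-- The inclusion of the sets of rank less than `η` into a marked rank. -/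
def incl (h : η ≤ γ) (x : {x : ZFSet.{u} // x.rank < η}) : MarkedRank A B γ :=
  ⟨x.1, x.2.trans_le h⟩

theorem incl_injective (h : η ≤ γ) : Function.Injective (incl (A := A) (B := B) h) :=
  fun x y e => by
    have := congrArg (fun z : MarkedRank A B γ => z.1) e
    exact Subtype.ext this

theorem realize_relativize (h : η ≤ γ) {w : MarkedRank A B γ} (hw : w.1 = ZFSet.vonNeumann η)
    {α : Type*} {n : ℕ} (φ : LStd.BoundedFormula α n) (v : α → {x : ZFSet.{u} // x.rank < η})
    (xs : Fin n → {x : ZFSet.{u} // x.rank < η}) :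
    let := VStructure η A
    (relativize φ).Realize (fun o => o.elim w (incl h ∘ v)) (incl h ∘ xs) ↔ φ.Realize v xs := by
  let := VStructure η A
  have hterm : ∀ {n : ℕ} (xs : Fin n → {x : ZFSet.{u} // x.rank < η})
      (t : LStd.Term (α ⊕ Fin n)),
      (t.relabel (Sum.map some id)).realize
        (Sum.elim (fun o : Option α => o.elim w (incl h ∘ v)) (incl h ∘ xs)) =
      incl (A := A) (B := B) h (t.realize (Sum.elim v xs)) := by
    intro n xs t
    cases t with
    | var i => cases i <;> rfl
    | func f _ => exact f.elim
  induction φ with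
  | falsum => rfl
  | equal s t =>
    change (_ =' _).Realize _ _ ↔ (_ =' _).Realize _ _
    rw [BoundedFormula.realize_bdEqual, BoundedFormula.realize_bdEqual, hterm, hterm]
    exact (incl_injective h).eq_iff
  | rel R ts =>
    cases R with
    | eps =>
      change (memFormula _ _).Realize _ _ ↔ _
      rw [realize_memFormula, hterm, hterm]
      rfl
    | r =>
      change (Relations.boundedFormula₁ rSymb _).Realize _ _ ↔ _
      rw [BoundedFormula.realize_rel₁, relMap_r]
      simp only [Matrix.cons_val_zero]
      rw [hterm]
      rfl
  | imp φ ψ ihφ ihψ =>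
    change ((relativize φ).imp (relativize ψ)).Realize _ _ ↔ (φ.imp ψ).Realize _ _
    rw [BoundedFormula.realize_imp, BoundedFormula.realize_imp]
    exact imp_congr (ihφ xs) (ihψ xs)
  | @all n φ ih =>
    change (BoundedFormula.all (BoundedFormula.imp _ _)).Realize _ _ ↔ φ.all.Realize _ _
    simp only [BoundedFormula.realize_all, BoundedFormula.realize_imp, realize_memFormula,
      Term.realize_var, Sum.elim_inl, Sum.elim_inr, Fin.snoc_last]
    constructor
    · intro H a
      have := H (incl h a) (by
        change a.1 ∈ w.1
        rw [hw]
        exact ZFSet.mem_vonNeumann.2 a.2)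
      rw [← Fin.comp_snoc] at this
      exact (ih _).1 this
    · intro H a ha
      have ha' : a.1.rank < η := by
        simpa [hw, ZFSet.mem_vonNeumann] using ha
      have := H ⟨a.1, ha'⟩
      have := (ih _).2 this
      rw [Fin.comp_snoc] at this
      exact this

theorem map_mem_iff (j : MarkedRank A B γ ↪ₑ[LStd] MarkedRank A B' γ')
    (x y : MarkedRank A B γ) : (j x).1 ∈ (j y).1 ↔ x.1 ∈ y.1 := by
  have := j.map_boundedFormula (memFormula (α := Fin 2) (n := 0)
    (Term.var (Sum.inl 0)) (Term.var (Sum.inl 1))) ![x, y] default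
  rw [realize_memFormula, realize_memFormula] at this
  exact this

theorem map_eq_empty_iff (j : MarkedRank A B γ ↪ₑ[LStd] MarkedRank A B' γ')
    (x : MarkedRank A B γ) : (j x).1 = ∅ ↔ x.1 = ∅ := by
  have := j.map_formula emptyFormula ![x]
  rw [realize_emptyFormula, realize_emptyFormula] at this
  exact this

theorem map_eq_upair_iff (j : MarkedRank A B γ ↪ₑ[LStd] MarkedRank A B' γ')
    (x y z : MarkedRank A B γ) : (j x).1 = {(j y).1, (j z).1} ↔ x.1 = {y.1, z.1} := by
  have := j.map_formula upairFormula ![x, y, z]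
  rw [realize_upairFormula, realize_upairFormula] at this
  exact this

theorem map_mark_iff (j : MarkedRank A B γ ↪ₑ[LStd] MarkedRank A B' γ')
    (x : MarkedRank A B γ) : (j x).1 ∈ B' ↔ x.1 ∈ B := by
  have := j.map_rel epsSymb ![x, x]
  rw [relMap_eps, relMap_eps] at this
  simpa [ZFSet.mem_irrefl] using this

theorem exists_restrict {η' : Ordinal.{u}} (j : MarkedRank A B γ ↪ₑ[LStd] MarkedRank A B' γ')
    (h : η < γ) (h' : η' < γ')
    (hj : (j ⟨ZFSet.vonNeumann η, by simpa using h⟩).1 = ZFSet.vonNeumann η') :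
    let := VStructure η A
    let := VStructure η' A
    ∃ k : {x : ZFSet.{u} // x.rank < η} ↪ₑ[LStd] {x : ZFSet.{u} // x.rank < η'},
      ∀ x, (k x).1 = (j (incl h.le x)).1 := by
  let := VStructure η A
  let := VStructure η' A
  let f : {x : ZFSet.{u} // x.rank < η} → {x : ZFSet.{u} // x.rank < η'} := fun x =>
    ⟨(j (incl h.le x)).1, by
      have := (map_mem_iff j (incl h.le x) ⟨ZFSet.vonNeumann η, by simpa using h⟩).2
        (ZFSet.mem_vonNeumann.2 x.2)
      rw [hj] at this
      exact ZFSet.mem_vonNeumann.1 this⟩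
  refine ⟨⟨f, fun n φ v => ?_⟩, fun x => rfl⟩
  have h1 := realize_relativize (A := A) (B := B) h.le
    (w := ⟨ZFSet.vonNeumann η, by simpa using h⟩) rfl φ v default
  have h2 := realize_relativize h'.le hj φ (f ∘ v) default
  rw [Formula.Realize, Formula.Realize]
  rw [Subsingleton.elim (incl _ ∘ default) default] at h1 h2
  refine h2.symm.trans (Iff.trans ?_ h1)
  have h3 := j.map_boundedFormula (relativize φ) (fun o => o.elim
    ⟨ZFSet.vonNeumann η, by simpa using h⟩ (incl h.le ∘ v)) default
  rw [← h3, Subsingleton.elim (j ∘ default) default]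
  refine iff_of_eq (congrArg (fun z => BoundedFormula.Realize (relativize φ) z default) ?_)
  funext o
  cases o <;> rfl

end MarkedRank

/-- The Zermelo numeral `n`. -/
def zermelo : ℕ → ZFSet.{u}
  | 0 => ∅
  | n + 1 => {zermelo n}

theorem rank_zermelo (n : ℕ) : (zermelo.{u} n).rank = n := by
  induction n with
  | zero => simp [zermelo]
  | succ n ih => simp [zermelo, ih]

theorem zermelo_injective : Function.Injective zermelo.{u} := fun m n e => by
  have := congrArg ZFSet.rank e
  rw [rank_zermelo, rank_zermelo] at this
  exact_mod_cast this

theorem rank_pair_lt {γ : Ordinal.{u}} (hγ : Order.IsSuccLimit γ) {x y : ZFSet.{u}}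
    (hx : x.rank < γ) (hy : y.rank < γ) : (ZFSet.pair x y).rank < γ := by
  rw [ZFSet.rank_kuratowski_pair, ← one_add_one_eq_two, ← add_assoc]
  exact hγ.add_one_lt (hγ.add_one_lt (max_lt hx hy))

theorem rank_zermelo_lt {γ : Ordinal.{u}} (hγ : Order.IsSuccLimit γ) (n : ℕ) :
    (zermelo.{u} n).rank < γ := by
  rw [rank_zermelo]
  exact Ordinal.natCast_lt_of_isSuccLimit hγ n

/-- `J` is induced by an elementary embedding between two marked ranks: it preserves membership,
pairs, Zermelo numerals and the tags, and it restricts to elementary embeddings of smaller ranks. -/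
structure IsTagEmbedding (A : Set ZFSet.{u}) (P P' : ℕ → ZFSet.{u} → Prop) (γ γ' : Ordinal.{u})
    (J : ZFSet.{u} → ZFSet.{u}) : Prop where
  rank_lt : ∀ {x}, x.rank < γ → (J x).rank < γ'
  inj : ∀ {x y}, x.rank < γ → y.rank < γ → J x = J y → x = y
  mem_iff : ∀ {x y}, x.rank < γ → y.rank < γ → (J x ∈ J y ↔ x ∈ y)
  pair : ∀ {x y}, x.rank < γ → y.rank < γ → J (ZFSet.pair x y) = ZFSet.pair (J x) (J y)
  zermelo : ∀ n, J (zermelo n) = zermelo n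
  tag_iff : ∀ {n x}, x.rank < γ → (P' n (J x) ↔ P n x)
  restrict : ∀ {η η'}, η < γ → J (ZFSet.vonNeumann η) = ZFSet.vonNeumann η' →
    letI := VStructure η A
    letI := VStructure η' A
    ∃ k : {x : ZFSet.{u} // x.rank < η} ↪ₑ[LStd] {x : ZFSet.{u} // x.rank < η'},
      ∀ x, (k x).1 = J x.1

/-- The set of marks coding the sequence of predicates `P`. -/
def tagSet (P : ℕ → ZFSet.{u} → Prop) : Set ZFSet.{u} :=
  {p | ∃ n x, p = ZFSet.pair (zermelo n) x ∧ P n x}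

theorem pair_mem_tagSet {P : ℕ → ZFSet.{u} → Prop} {n : ℕ} {x : ZFSet.{u}} :
    ZFSet.pair (zermelo n) x ∈ tagSet P ↔ P n x := by
  constructor
  · rintro ⟨m, y, e, h⟩
    obtain ⟨h1, rfl⟩ := ZFSet.pair_inj.1 e
    obtain rfl := zermelo_injective h1
    exact h
  · exact fun h => ⟨n, x, rfl, h⟩

theorem isTagEmbedding_of_elementaryEmbedding {A : Set ZFSet.{u}} {P P' : ℕ → ZFSet.{u} → Prop}
    {γ γ' : Ordinal.{u}} (hγ : Order.IsSuccLimit γ)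
    (j : MarkedRank A (tagSet P) γ ↪ₑ[LStd] MarkedRank A (tagSet P') γ') :
    ∃ J, IsTagEmbedding A P P' γ γ' J := by
  classical
  let J : ZFSet.{u} → ZFSet.{u} := fun x => if h : x.rank < γ then (j ⟨x, h⟩).1 else ∅
  have hJ : ∀ {x} (h : x.rank < γ), J x = (j ⟨x, h⟩).1 := fun h => dif_pos h
  have hlt : ∀ {x}, x.rank < γ → (J x).rank < γ' := fun h => by
    rw [hJ h]
    exact (j ⟨_, h⟩).2
  have hup : ∀ {x y}, x.rank < γ → y.rank < γ →
      ({x, y} : ZFSet.{u}).rank < γ ∧ J {x, y} = {J x, J y} := fun {x y} hx hy => by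
    have h : ({x, y} : ZFSet.{u}).rank < γ := by
      rw [ZFSet.rank_pair]
      exact max_lt (hγ.succ_lt hx) (hγ.succ_lt hy)
    refine ⟨h, ?_⟩
    rw [hJ hx, hJ hy, hJ h]
    exact (MarkedRank.map_eq_upair_iff j ⟨_, h⟩ ⟨_, hx⟩ ⟨_, hy⟩).2 rfl
  have hsing : ∀ {x}, x.rank < γ → ({x} : ZFSet.{u}).rank < γ ∧ J {x} = {J x} := fun {x} hx => by
    have := hup hx hx
    rwa [ZFSet.pair_eq_singleton, ZFSet.pair_eq_singleton] at this
  have hpair : ∀ {x y}, x.rank < γ → y.rank < γ →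
      J (ZFSet.pair x y) = ZFSet.pair (J x) (J y) := fun {x y} hx hy => by
    rw [ZFSet.pair, ZFSet.pair, (hup (hsing hx).1 (hup hx hy).1).2, (hsing hx).2, (hup hx hy).2]
  have hz : ∀ n, J (zermelo n) = zermelo n := fun n => by
    induction n with
    | zero =>
      rw [hJ (rank_zermelo_lt hγ 0)]
      exact (MarkedRank.map_eq_empty_iff j ⟨_, _⟩).2 rfl
    | succ n ih =>
      rw [zermelo, (hsing (rank_zermelo_lt hγ n)).2, ih]
  refine ⟨J, hlt, fun {x y} hx hy e => ?_, fun {x y} hx hy => ?_, hpair, hz,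
    fun {n x} hx => ?_, fun {η η'} h e => ?_⟩
  · rw [hJ hx, hJ hy] at e
    exact congrArg (fun z : MarkedRank A (tagSet P) γ => z.1) (j.injective (Subtype.ext e))
  · rw [hJ hx, hJ hy]
    exact MarkedRank.map_mem_iff j _ _
  · have hp := rank_pair_lt hγ (rank_zermelo_lt hγ n) hx
    have e := hpair (rank_zermelo_lt hγ n) hx
    rw [hz n, hJ hp] at e
    rw [← pair_mem_tagSet (P := P'), ← pair_mem_tagSet (P := P), ← e]
    exact MarkedRank.map_mark_iff j _
  · have hη : (ZFSet.vonNeumann η).rank < γ := by simpa using h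
    have h' : η' < γ' := by
      have := hlt hη
      rwa [e, ZFSet.rank_vonNeumann] at this
    obtain ⟨k, hk⟩ := MarkedRank.exists_restrict j h h' ((hJ hη).symm.trans e)
    exact ⟨k, fun x => (hk x).trans (hJ _).symm⟩

/-- The binary relation of a marked rank, as a set of pairs. -/
noncomputable def rankCodeRel (B : Set ZFSet.{u}) (γ : Ordinal.{u}) : ZFSet.{u} :=
  ((ZFSet.vonNeumann γ).prod (ZFSet.vonNeumann γ)).sep fun p =>
    ∃ x y, p = ZFSet.pair x y ∧ (x ∈ y ∨ (x = y ∧ x ∈ B))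

theorem pair_mem_rankCodeRel {B : Set ZFSet.{u}} {γ : Ordinal.{u}} {x y : ZFSet.{u}}
    (hx : x.rank < γ) (hy : y.rank < γ) :
    ZFSet.pair x y ∈ rankCodeRel B γ ↔ x ∈ y ∨ (x = y ∧ x ∈ B) := by
  rw [rankCodeRel, ZFSet.mem_sep, ZFSet.pair_mem_prod]
  constructor
  · rintro ⟨-, x', y', e, h⟩
    obtain ⟨rfl, rfl⟩ := ZFSet.pair_inj.1 e
    exact h
  · exact fun h => ⟨⟨ZFSet.mem_vonNeumann.2 hx, ZFSet.mem_vonNeumann.2 hy⟩, x, y, rfl, h⟩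

/-- The code of a marked rank. -/
noncomputable def rankCode (A : ZFSet.{u}) (B : Set ZFSet.{u}) (γ : Ordinal.{u}) : ZFSet.{u} :=
  (ZFSet.vonNeumann γ).pair ((rankCodeRel B γ).pair (ZFSet.vonNeumann γ ∩ A))

theorem isLStdCode_rankCode (A : ZFSet.{u}) (B : Set ZFSet.{u}) (γ : Ordinal.{u}) :
    IsLStdCode (rankCode A B γ) :=
  ⟨_, _, _, rfl, fun _ hp => ZFSet.mem_prod.1 (ZFSet.mem_sep.1 hp).1,
    fun _ hx => (ZFSet.mem_inter.1 hx).1⟩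

theorem rank_rankCode_lt (A : ZFSet.{u}) (B : Set ZFSet.{u}) {γ δ : Ordinal.{u}}
    (hγ : Order.IsSuccLimit γ) (hδ : Order.IsSuccLimit δ) (h : γ < δ) :
    (rankCode A B γ).rank < δ := by
  have hle : ∀ x : ZFSet.{u}, x ⊆ ZFSet.vonNeumann γ → x.rank < δ := fun x hx =>
    (ZFSet.rank_le_iff.2 fun y hy => ZFSet.mem_vonNeumann.1 (hx hy)).trans_lt h
  refine rank_pair_lt hδ (hle _ fun _ => id) (rank_pair_lt hδ (hle _ fun p hp => ?_)
    (hle _ fun _ hx => (ZFSet.mem_inter.1 hx).1))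
  obtain ⟨x, hx, y, hy, rfl⟩ := ZFSet.mem_prod.1 (ZFSet.mem_sep.1 hp).1
  exact ZFSet.mem_vonNeumann.2
    (rank_pair_lt hγ (ZFSet.mem_vonNeumann.1 hx) (ZFSet.mem_vonNeumann.1 hy))

/-- A marked rank is isomorphic to the structure coded by its code. -/
noncomputable def rankCodeEquiv (A : ZFSet.{u}) (B : Set ZFSet.{u}) (γ : Ordinal.{u}) :
    letI := codedStructure (ZFSet.vonNeumann γ) (rankCodeRel B γ) (ZFSet.vonNeumann γ ∩ A)
    MarkedRank A.toSet B γ ≃[LStd] (ZFSet.vonNeumann γ).toSet :=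
  letI := codedStructure (ZFSet.vonNeumann γ) (rankCodeRel B γ) (ZFSet.vonNeumann γ ∩ A)
  { toFun := fun x => ⟨x.1, ZFSet.mem_vonNeumann.2 x.2⟩
    invFun := fun x => ⟨x.1, ZFSet.mem_vonNeumann.1 x.2⟩
    left_inv := fun _ => rfl
    right_inv := fun _ => rfl
    map_fun' := fun f => f.elim
    map_rel' := fun {n} R x => by
      cases R with
      | eps =>
        refine (pair_mem_rankCodeRel (x 0).2 (x 1).2).trans ?_
        refine or_congr Iff.rfl (and_congr_left fun _ => ?_)
        exact ⟨fun e => Subtype.ext e, fun e => congrArg (fun z : MarkedRank A.toSet B γ => z.1) e⟩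
      | r =>
        exact ZFSet.mem_inter.trans (and_iff_right (ZFSet.mem_vonNeumann.2 (x 0).2)) }

theorem exists_elementaryEmbedding_of_elemEmbeddable {A : ZFSet.{u}} {B B' : Set ZFSet.{u}}
    {γ γ' : Ordinal.{u}} (h : ElemEmbeddable (rankCode A B γ) (rankCode A B' γ')) :
    Nonempty (MarkedRank A.toSet B γ ↪ₑ[LStd] MarkedRank A.toSet B' γ') := by
  obtain ⟨M, E, R, N, E', R', e, e', ⟨j⟩⟩ := h
  obtain ⟨rfl, h⟩ := ZFSet.pair_inj.1 e
  obtain ⟨rfl, rfl⟩ := ZFSet.pair_inj.1 h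
  obtain ⟨rfl, h⟩ := ZFSet.pair_inj.1 e'
  obtain ⟨rfl, rfl⟩ := ZFSet.pair_inj.1 h
  let := codedStructure (ZFSet.vonNeumann γ) (rankCodeRel B γ) (ZFSet.vonNeumann γ ∩ A)
  let := codedStructure (ZFSet.vonNeumann γ') (rankCodeRel B' γ') (ZFSet.vonNeumann γ' ∩ A)
  exact ⟨(rankCodeEquiv A B' γ').symm.toElementaryEmbedding.comp
    (j.comp (rankCodeEquiv A B γ).toElementaryEmbedding)⟩

theorem IsVopenka.exists_isTagEmbedding {κ : Cardinal.{u}} (hκ : IsVopenka κ) (A : ZFSet.{u})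
    (P : Ordinal.{u} → ℕ → ZFSet.{u} → Prop) (hP : ∀ a x, P a 0 x ↔ x = ZFSet.vonNeumann a)
    (γ : Ordinal.{u} → Ordinal.{u}) (hγ : ∀ a < κ.ord, γ a < κ.ord) (hlt : ∀ a, a < γ a)
    (hlim : ∀ a, Order.IsSuccLimit (γ a)) :
    ∃ a < κ.ord, ∃ a' < κ.ord, a ≠ a' ∧
      ∃ J, IsTagEmbedding A.toSet (P a) (P a') (γ a) (γ a') J := by
  let S : Set.Iio κ.ord → ZFSet.{u} := fun a => rankCode A (tagSet (P a)) (γ a)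
  have hmem : ∀ a b : Ordinal.{u}, b < γ a →
      (ZFSet.pair (ZFSet.pair (zermelo 0) (ZFSet.vonNeumann b))
        (ZFSet.pair (zermelo 0) (ZFSet.vonNeumann b)) ∈ rankCodeRel (tagSet (P a)) (γ a) ↔
          b = a) := by
    intro a b hb
    have hr : (ZFSet.pair (zermelo 0) (ZFSet.vonNeumann b)).rank < γ a :=
      rank_pair_lt (hlim a) (rank_zermelo_lt (hlim a) 0) (by simpa using hb)
    rw [pair_mem_rankCodeRel hr hr, pair_mem_tagSet, hP, ZFSet.vonNeumann_inj]
    simp [ZFSet.mem_irrefl]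
  have hS : Function.Injective S := by
    intro a b e
    obtain ⟨e1, e⟩ := ZFSet.pair_inj.1 e
    obtain ⟨e2, -⟩ := ZFSet.pair_inj.1 e
    have h := (hmem a a (hlt a)).2 rfl
    rw [e2] at h
    exact Subtype.ext ((hmem b a (ZFSet.vonNeumann_inj.1 e1 ▸ hlt a)).1 h)
  have hκlim : Order.IsSuccLimit κ.ord := Cardinal.isSuccLimit_ord hκ.1.aleph0_lt.le
  obtain ⟨_, hM, _, hN, hne, hemb⟩ := hκ.2 (ZFSet.range S)
    (fun x hx => by
      obtain ⟨a, rfl⟩ := ZFSet.mem_range.1 hx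
      exact rank_rankCode_lt A _ (hlim a) hκlim (hγ a a.2))
    (by
      have : (ZFSet.range S).toSet = Set.range S := ZFSet.coe_range S
      rw [this, mk_range_eq S hS, Cardinal.mk_Iio_ordinal, Cardinal.card_ord])
    (fun x hx => by
      obtain ⟨a, rfl⟩ := ZFSet.mem_range.1 hx
      exact isLStdCode_rankCode A _ _)
  obtain ⟨a, rfl⟩ := ZFSet.mem_range.1 hM
  obtain ⟨b, rfl⟩ := ZFSet.mem_range.1 hN
  obtain ⟨j⟩ := exists_elementaryEmbedding_of_elemEmbeddable hemb
  exact ⟨a, a.2, b, b.2, fun e => hne (congrArg S (Subtype.ext e)),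
    isTagEmbedding_of_elementaryEmbedding (hlim a) j⟩

/-- `nxt a` is a limit of cofinality `ω` above `a` that is closed under `g`; it depends
monotonically on `a`, and `c` is closed under `nxt`. -/
structure IsClosureMap (c : Ordinal.{u}) (g nxt : Ordinal.{u} → Ordinal.{u}) : Prop where
  mono : Monotone nxt
  lt_self : ∀ a, a < nxt a
  isSuccLimit : ∀ a, Order.IsSuccLimit (nxt a)
  lt : ∀ {a x}, x < nxt a → g x < nxt a
  bound : ∀ {a}, a < c → nxt a < c
  cofinal : ∀ a, ∃ s : ℕ → Ordinal.{u}, (∀ n, s n < nxt a) ∧ ∀ x < nxt a, ∃ n, x < s n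

theorem exists_isClosureMap {κ : Cardinal.{u}} (hκ : κ.IsRegular) (hω : ℵ₀ < κ)
    (g : Ordinal.{u} → Ordinal.{u}) (hg : ∀ x < κ.ord, g x < κ.ord) :
    ∃ nxt, IsClosureMap κ.ord g nxt := by
  have hlim : Order.IsSuccLimit κ.ord := Cardinal.isSuccLimit_ord hω.le
  let G : Ordinal.{u} → Ordinal.{u} := fun x => ⨆ y : Set.Iio (x + 1), max (g y) y + 1
  have hle : ∀ {x y}, y ≤ x → max (g y) y + 1 ≤ G x := fun {x y} h =>
    Ordinal.le_iSup (fun y : Set.Iio (x + 1) => max (g y) y + 1) ⟨y, Order.lt_add_one_iff.2 h⟩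
  have hmono : Monotone G := fun x y h =>
    Ordinal.iSup_le fun z => hle ((Order.lt_add_one_iff.1 z.2).trans h)
  have hlt : ∀ x, x < G x := fun x =>
    (Order.lt_add_one_iff.2 (le_max_right _ _)).trans_le (hle le_rfl)
  have hglt : ∀ x, g x < G x := fun x =>
    (Order.lt_add_one_iff.2 (le_max_left _ _)).trans_le (hle le_rfl)
  have hG : ∀ x < κ.ord, G x < κ.ord := by
    intro x hx
    refine Ordinal.lift_iSup_lt_of_lt_cof ?_ fun y => ?_
    · rw [Cardinal.mk_Iio_ordinal, ← Ordinal.lift_cof, hκ.cof_ord, Cardinal.lift_lift,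
        Cardinal.lift_lt]
      exact Cardinal.lt_ord.1 (hlim.add_one_lt hx)
    · have hy : (y : Ordinal) < κ.ord := y.2.trans (hlim.add_one_lt hx)
      exact hlim.add_one_lt (max_lt (hg _ hy) hy)
  have hstep : ∀ {a x}, x < Ordinal.nfp G (a + 1) → G x < Ordinal.nfp G (a + 1) := by
    intro a x hx
    obtain ⟨n, hn⟩ := Ordinal.lt_nfp_iff.1 hx
    refine Ordinal.lt_nfp_iff.2 ⟨n + 2, ?_⟩
    rw [Function.iterate_succ_apply', Function.iterate_succ_apply']
    exact (hmono hn.le).trans_lt (hlt _)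
  have hself : ∀ a, a < Ordinal.nfp G (a + 1) := fun a =>
    (lt_add_one a).trans_le (Ordinal.le_nfp _ _)
  refine ⟨fun a => Ordinal.nfp G (a + 1), fun a b h => Ordinal.nfp_monotone hmono (by gcongr),
    hself, fun a => ?_, fun h => (hglt _).trans (hstep h),
    fun h => Cardinal.nfp_lt_ord_of_isRegular hκ hω.ne' hG (hlim.add_one_lt h),
    fun a => ⟨fun n => G^[n] (a + 1), fun n => Ordinal.lt_nfp_iff.2 ⟨n + 1, ?_⟩,
      fun x hx => Ordinal.lt_nfp_iff.1 hx⟩⟩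
  · refine Ordinal.isSuccLimit_iff.2 ⟨(bot_le.trans_lt (hself a)).ne', ?_⟩
    exact Order.isSuccPrelimit_of_succ_lt fun x hx =>
      (Order.succ_le_of_lt (hlt x)).trans_lt (hstep hx)
  · rw [Function.iterate_succ_apply']
    exact hlt _

theorem zfIsCardinal_toZFSet {ξ : Ordinal.{u}} (h : ∀ x < ξ, (Order.succ x.card).ord ≤ ξ) :
    ZFIsCardinal ξ.toZFSet := by
  refine ⟨ZFSet.isOrdinal_toZFSet ξ, fun β hβ => ?_⟩
  obtain ⟨b, hb, rfl⟩ := Ordinal.mem_toZFSet_iff.1 hβ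
  have hcard : ∀ o : Ordinal.{u}, #o.toZFSet.toSet = Cardinal.lift.{u + 1} o.card := fun o =>
    ZFSet.cardinalMk_coe_sort.trans (by rw [Ordinal.card_toZFSet])
  rw [hcard, hcard, Cardinal.lift_lt]
  exact (Order.lt_succ _).trans_le (Cardinal.ord_le.1 (h b hb))

/-- The graph of the sequence `σ`, as a set. -/
noncomputable def seqCode (σ : ℕ → ZFSet.{u}) : ZFSet.{u} :=
  ZFSet.range fun n => ZFSet.pair (zermelo n) (σ n)

theorem pair_mem_seqCode {σ : ℕ → ZFSet.{u}} {n : ℕ} {x : ZFSet.{u}} :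
    ZFSet.pair (zermelo n) x ∈ seqCode σ ↔ x = σ n := by
  rw [seqCode, ZFSet.mem_range]
  constructor
  · rintro ⟨m, e⟩
    obtain ⟨h1, rfl⟩ := ZFSet.pair_inj.1 e
    rw [zermelo_injective h1]
  · rintro rfl
    exact ⟨n, rfl⟩

theorem rank_seqCode_lt {γ δ : Ordinal.{u}} (hγ : Order.IsSuccLimit γ) (h : γ < δ)
    {σ : ℕ → ZFSet.{u}} (hσ : ∀ n, (σ n).rank < γ) : (seqCode σ).rank < δ := by
  refine (ZFSet.rank_le_iff.2 fun p hp => ?_).trans_lt h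
  obtain ⟨n, rfl⟩ := ZFSet.mem_range.1 hp
  exact rank_pair_lt hγ (rank_zermelo_lt hγ n) (hσ n)

/-- The predicates that an embedding of marked ranks is required to preserve. The first one
distinguishes the structures with different `a`. -/
def Tag (nxt : Ordinal.{u} → Ordinal.{u})
    (f : ∀ τ : Ordinal.{u}, OmegaOp τ) (a : Ordinal.{u}) : ℕ → ZFSet.{u} → Prop
  | 0, x => x = ZFSet.vonNeumann a
  | 1, x => ∃ ζ, x = ZFSet.vonNeumann ζ
  | 2, x => ∃ ρ, x = ZFSet.pair (ZFSet.vonNeumann ρ) (ZFSet.vonNeumann (nxt ρ))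
  | 3, x => ∃ ξ, x = ZFSet.vonNeumann ξ ∧ ∀ ρ < ξ, nxt ρ < ξ
  | 4, x => ∃ ζ : Ordinal.{u}, x = ZFSet.pair (ZFSet.vonNeumann ζ) ζ.toZFSet
  | 5, x => ∃ τ σ, x = ZFSet.pair (ZFSet.vonNeumann τ)
      (ZFSet.pair (seqCode fun n => (σ n).1) (f τ σ).1)
  | _, _ => False

namespace IsTagEmbedding

variable {A : Set ZFSet.{u}} {nxt : Ordinal.{u} → Ordinal.{u}}
  {f : ∀ τ : Ordinal.{u}, OmegaOp τ}
  {a a' γ γ' : Ordinal.{u}} {J : ZFSet.{u} → ZFSet.{u}}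

theorem exists_map_vonNeumann (hJ : IsTagEmbedding A (Tag nxt f a) (Tag nxt f a') γ γ' J)
    {ζ : Ordinal.{u}} (h : ζ < γ) : ∃ ζ', J (ZFSet.vonNeumann ζ) = ZFSet.vonNeumann ζ' :=
  (hJ.tag_iff (n := 1) (by simpa using h)).2 ⟨ζ, rfl⟩

theorem map_pair_toZFSet (hJ : IsTagEmbedding A (Tag nxt f a) (Tag nxt f a') γ γ' J)
    (hγ : Order.IsSuccLimit γ) {ζ ζ' : Ordinal.{u}} (h : ζ < γ)
    (e : J (ZFSet.vonNeumann ζ) = ZFSet.vonNeumann ζ') : J ζ.toZFSet = ζ'.toZFSet := by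
  have h1 : (ZFSet.vonNeumann ζ).rank < γ := by simpa using h
  have h2 : ζ.toZFSet.rank < γ := by simpa using h
  obtain ⟨ξ, hξ⟩ := (hJ.tag_iff (n := 4) (rank_pair_lt hγ h1 h2)).2 ⟨ζ, rfl⟩
  rw [hJ.pair h1 h2, e] at hξ
  obtain ⟨e1, e2⟩ := ZFSet.pair_inj.1 hξ
  rw [e2, ZFSet.vonNeumann_inj.1 e1]

theorem map_vonNeumann_nxt (hJ : IsTagEmbedding A (Tag nxt f a) (Tag nxt f a') γ γ' J)
    (hγ : Order.IsSuccLimit γ) {ρ : Ordinal.{u}} (h : ρ < γ) (h' : nxt ρ < γ)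
    (e : J (ZFSet.vonNeumann ρ) = ZFSet.vonNeumann ρ) :
    J (ZFSet.vonNeumann (nxt ρ)) = ZFSet.vonNeumann (nxt ρ) := by
  have h1 : (ZFSet.vonNeumann ρ).rank < γ := by simpa using h
  have h2 : (ZFSet.vonNeumann (nxt ρ)).rank < γ := by simpa using h'
  obtain ⟨ξ, hξ⟩ := (hJ.tag_iff (n := 2) (rank_pair_lt hγ h1 h2)).2 ⟨ρ, rfl⟩
  rw [hJ.pair h1 h2, e] at hξ
  obtain ⟨e1, e2⟩ := ZFSet.pair_inj.1 hξ
  rw [e2, ZFSet.vonNeumann_inj.1 e1]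

theorem surjOn (hJ : IsTagEmbedding A (Tag nxt f a) (Tag nxt f a') γ γ' J)
    (hγ : Order.IsSuccLimit γ) {τ : Ordinal.{u}} (hτ : Order.IsSuccLimit τ) (h : τ < γ)
    (hf : (f τ).IsJonsson)
    (e : J (ZFSet.vonNeumann τ) = ZFSet.vonNeumann τ) {y : ZFSet.{u}} (hy : y.rank < τ) :
    ∃ x, x.rank < τ ∧ J x = y := by
  have hVτ : (ZFSet.vonNeumann τ).rank < γ := by simpa using h
  have hmaps : ∀ x : ZFSet.{u}, x.rank < τ → (J x).rank < τ := fun x hx => by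
    have := (hJ.mem_iff (hx.trans h) hVτ).2 (ZFSet.mem_vonNeumann.2 hx)
    rw [e] at this
    exact ZFSet.mem_vonNeumann.1 this
  let k : {x : ZFSet.{u} // x.rank < τ} → {x : ZFSet.{u} // x.rank < τ} :=
    fun x => ⟨J x.1, hmaps x.1 x.2⟩
  have hk : Function.Injective k := fun x z ez =>
    Subtype.ext (hJ.inj (x.2.trans h) (z.2.trans h) (congrArg Subtype.val ez))
  obtain ⟨σ, hσ⟩ := hf k hk ⟨y, hy⟩
  refine ⟨(f τ σ).1, (f τ σ).2, ?_⟩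
  have hs : (seqCode fun n => (σ n).1).rank < γ := rank_seqCode_lt hτ h fun n => (σ n).2
  have hfs : (f τ σ).1.rank < γ := (f τ σ).2.trans h
  have hp := rank_pair_lt hγ hs hfs
  obtain ⟨τ₁, σ₁, h₁⟩ := (hJ.tag_iff (n := 5) (rank_pair_lt hγ hVτ hp)).2 ⟨τ, σ, rfl⟩
  rw [hJ.pair hVτ hp, hJ.pair hs hfs, e] at h₁
  obtain ⟨e1, e2⟩ := ZFSet.pair_inj.1 h₁
  obtain rfl := ZFSet.vonNeumann_inj.1 e1
  obtain ⟨e3, e4⟩ := ZFSet.pair_inj.1 e2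
  have : σ₁ = fun n => k (σ n) := by
    funext n
    have hz := rank_zermelo_lt hγ n
    have hσn := (σ n).2.trans h
    have hm := (hJ.mem_iff (rank_pair_lt hγ hz hσn) hs).2 (pair_mem_seqCode.2 rfl)
    rw [hJ.pair hz hσn, hJ.zermelo, e3, pair_mem_seqCode] at hm
    exact Subtype.ext hm.symm
  rw [e4, this, hσ]

theorem map_vonNeumann_of_le_nxt (hJ : IsTagEmbedding A (Tag nxt f a) (Tag nxt f a') γ γ' J)
    (hγ : Order.IsSuccLimit γ) {ρ ξ : Ordinal.{u}} (hρ : ρ < ξ) (hξ : ξ ≤ nxt ρ)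
    (hlim : Order.IsSuccLimit (nxt ρ)) (h : nxt ρ < γ)
    (hf : (f (nxt ρ)).IsJonsson)
    (hfix : ∀ ζ < ξ, J (ZFSet.vonNeumann ζ) = ZFSet.vonNeumann ζ) :
    J (ZFSet.vonNeumann ξ) = ZFSet.vonNeumann ξ := by
  have hn := hJ.map_vonNeumann_nxt hγ (hρ.trans_le (hξ.trans h.le)) h (hfix ρ hρ)
  rcases hξ.eq_or_lt with rfl | hξ
  · exact hn
  have hVξ : (ZFSet.vonNeumann ξ).rank < γ := by simpa using hξ.trans h
  obtain ⟨x, hx, ex⟩ := hJ.surjOn hγ hlim h hf hn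
    (show (ZFSet.vonNeumann ξ).rank < nxt ρ by simpa using hξ)
  obtain ⟨ζ, rfl⟩ := (hJ.tag_iff (n := 1) (hx.trans h)).1 ⟨ξ, ex⟩
  rcases lt_trichotomy ζ ξ with hζ | rfl | hζ
  · rw [hfix ζ hζ] at ex
    exact absurd (ZFSet.vonNeumann_inj.1 ex) hζ.ne
  · exact ex
  · obtain ⟨ξ', hξ'⟩ := hJ.exists_map_vonNeumann (hξ.trans h)
    have hm := (hJ.mem_iff hVξ (hx.trans h)).2 (ZFSet.vonNeumann_mem_vonNeumann_iff.2 hζ)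
    rw [ex, hξ', ZFSet.vonNeumann_mem_vonNeumann_iff] at hm
    have := hJ.inj hVξ (by simpa using (hm.trans hξ).trans h) (hξ'.trans (hfix ξ' hm).symm)
    exact absurd (ZFSet.vonNeumann_inj.1 this) hm.ne'

theorem exists_critical (hJ : IsTagEmbedding A (Tag nxt f a) (Tag nxt f a') γ γ' J)
    {c : Ordinal.{u}} {g : Ordinal.{u} → Ordinal.{u}} (hnxt : IsClosureMap c g nxt)
    (hγ : Order.IsSuccLimit γ) (ha : nxt a < γ) (hne : a ≠ a')
    (hf : ∀ ρ, (f (nxt ρ)).IsJonsson) :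
    ∃ ξ ≤ a, (∀ ρ < ξ, nxt ρ < ξ) ∧ (∀ ζ < ξ, J (ZFSet.vonNeumann ζ) = ZFSet.vonNeumann ζ) ∧
      ∃ ξ', J (ZFSet.vonNeumann ξ) = ZFSet.vonNeumann ξ' ∧ nxt ξ < ξ' := by
  have haγ : a < γ := (hnxt.lt_self a).trans ha
  have hmove : J (ZFSet.vonNeumann a) ≠ ZFSet.vonNeumann a := by
    intro e
    have h : J (ZFSet.vonNeumann a) = ZFSet.vonNeumann a' :=
      (hJ.tag_iff (n := 0) (by simpa using haγ)).2 rfl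
    exact hne (ZFSet.vonNeumann_inj.1 (e.symm.trans h))
  obtain ⟨ξ, hξ, hmin⟩ := WellFounded.has_min (wellFounded_lt (α := Ordinal.{u}))
    {ξ | J (ZFSet.vonNeumann ξ) ≠ ZFSet.vonNeumann ξ} ⟨a, hmove⟩
  have hξa : ξ ≤ a := not_lt.1 (hmin a hmove)
  have hfix : ∀ ζ < ξ, J (ZFSet.vonNeumann ζ) = ZFSet.vonNeumann ζ :=
    fun ζ hζ => not_not.1 fun hn => hmin ζ hn hζ
  have hVξ : (ZFSet.vonNeumann ξ).rank < γ := by simpa using hξa.trans_lt haγ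
  have hclosed : ∀ ρ < ξ, nxt ρ < ξ := by
    intro ρ hρ
    by_contra! hle
    exact hξ (hJ.map_vonNeumann_of_le_nxt hγ hρ hle (hnxt.isSuccLimit ρ)
      ((hnxt.mono (hρ.le.trans hξa)).trans_lt ha) (hf ρ) hfix)
  obtain ⟨ξ', e, hclosed'⟩ := (hJ.tag_iff (n := 3) hVξ).2 ⟨ξ, rfl, hclosed⟩
  refine ⟨ξ, hξa, hclosed, hfix, ξ', e, hclosed' ξ ?_⟩
  rcases lt_trichotomy ξ ξ' with h | rfl | h
  · exact h
  · exact absurd e hξ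
  · have := hJ.inj hVξ (by simpa using h.trans (hξa.trans_lt haγ)) (e.trans (hfix ξ' h).symm)
    exact absurd (ZFSet.vonNeumann_inj.1 this) h.ne'

theorem extWitness (hJ : IsTagEmbedding A (Tag nxt f a) (Tag nxt f a') γ γ' J)
    (hγ : Order.IsSuccLimit γ) {ξ ξ' η ζ : Ordinal.{u}}
    (hfix : ∀ ζ < ξ, J (ZFSet.vonNeumann ζ) = ZFSet.vonNeumann ζ)
    (hξ : J (ZFSet.vonNeumann ξ) = ZFSet.vonNeumann ξ') (hlt : ξ < η) (hη : η < ξ') (hηγ : η < γ)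
    (hζ : J (ZFSet.vonNeumann η) = ZFSet.vonNeumann ζ) :
    ExtWitness A ξ.toZFSet η.toZFSet ζ.toZFSet := by
  obtain ⟨k, hk⟩ := hJ.restrict hηγ hζ
  rw [ExtWitness, Ordinal.rank_toZFSet, Ordinal.rank_toZFSet]
  refine ⟨k, fun β hβ hβξ => ?_, fun hα => ?_⟩
  · obtain ⟨b, hb, rfl⟩ := Ordinal.mem_toZFSet_iff.1 hβξ
    rw [hk]
    exact hJ.map_pair_toZFSet hγ ((hb.trans hlt).trans hηγ) (hfix b hb)
  · rw [hk, hJ.map_pair_toZFSet hγ (hlt.trans hηγ) hξ]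
    exact ⟨fun e => (hlt.trans hη).ne' (Ordinal.toZFSet_injective e),
      Ordinal.toZFSet_mem_toZFSet_iff.2 hη⟩

end IsTagEmbedding

/-- If `κ` is a Vopěnka cardinal, then for every set `A ⊆ V_κ` there is a cardinal `α < κ`
that is extendible below `κ` for `A`: for every ordinal `η` with `α < η < κ` there exist
`ζ < κ` and an elementary embedding `j : ⟨V_η, ∈, A ∩ V_η⟩ → ⟨V_ζ, ∈, A ∩ V_ζ⟩` with critical
point `α` and `j α > η`. -/
theorem extendibleBelow_of_isVopenka (κ : Cardinal.{u}) (hκ : IsVopenka κ) :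
    ∀ A : ZFSet.{u}, (∀ x ∈ A, x.rank < κ.ord) →
      ∃ α : ZFSet.{u}, ZFIsCardinal α ∧ α.rank < κ.ord ∧
        ∀ η : ZFSet.{u}, η.IsOrdinal → α ∈ η → η.rank < κ.ord →
          ∃ ζ : ZFSet.{u}, ζ.IsOrdinal ∧ ζ.rank < κ.ord ∧ ExtWitness A.toSet α η ζ := by
  intro A _
  by_contra! hno
  have hreg := hκ.1.isRegular
  have hω := hκ.1.aleph0_lt
  have hκlim : Order.IsSuccLimit κ.ord := Cardinal.isSuccLimit_ord hω.le
  have hex : ∀ ξ : Ordinal.{u}, ∃ e : Ordinal.{u}, (ξ < κ.ord → e < κ.ord) ∧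
      (ξ < κ.ord → ZFIsCardinal ξ.toZFSet → ξ < e ∧
        ∀ ζ : Ordinal.{u}, ζ < κ.ord → ¬ ExtWitness A.toSet ξ.toZFSet e.toZFSet ζ.toZFSet) := by
    intro ξ
    by_cases hξ : ξ < κ.ord ∧ ZFIsCardinal ξ.toZFSet
    · obtain ⟨η, hη, hmem, hlt, hn⟩ := hno ξ.toZFSet hξ.2 (by simpa using hξ.1)
      rw [← hη.toZFSet_rank_eq, Ordinal.toZFSet_mem_toZFSet_iff] at hmem
      refine ⟨η.rank, fun _ => hlt, fun _ _ => ⟨hmem, fun ζ hζ => ?_⟩⟩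
      rw [hη.toZFSet_rank_eq]
      exact hn ζ.toZFSet (ZFSet.isOrdinal_toZFSet ζ) (by simpa using hζ)
    · exact ⟨0, fun _ => hκlim.bot_lt, fun h1 h2 => absurd ⟨h1, h2⟩ hξ⟩
  choose e he hext using hex
  obtain ⟨nxt, hnxt⟩ := exists_isClosureMap hreg hω
    (fun x => max (e x) (Order.succ x.card).ord) fun x hx => max_lt (he x hx)
      (Cardinal.ord_lt_ord.2 (hκ.1.isStrongLimit.isSuccLimit.succ_lt (Cardinal.lt_ord.1 hx)))
  have hf : ∀ τ : Ordinal.{u}, ∃ f : OmegaOp τ,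
      (∃ s : ℕ → Ordinal.{u}, (∀ n, s n < τ) ∧ ∀ x < τ, ∃ n, x < s n) → f.IsJonsson := by
    intro τ
    by_cases hs : ∃ s : ℕ → Ordinal.{u}, (∀ n, s n < τ) ∧ ∀ x < τ, ∃ n, x < s n
    · obtain ⟨s, hs, hcof⟩ := hs
      obtain ⟨f, hf⟩ := OmegaOp.exists_isJonsson s hs hcof
      exact ⟨f, fun _ => hf⟩
    · exact ⟨fun σ => σ 0, fun h => absurd h hs⟩
  choose f hf using hf
  have hγlim : ∀ a, Order.IsSuccLimit (nxt a + Ordinal.omega0) := fun a =>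
    Ordinal.isSuccLimit_add _ Ordinal.isSuccLimit_omega0
  have hlt : ∀ a, nxt a < nxt a + Ordinal.omega0 := fun a =>
    lt_add_of_pos_right _ Ordinal.omega0_pos
  have hωκ : Ordinal.omega0 < κ.ord := by
    rw [← Cardinal.ord_aleph0]
    exact Cardinal.ord_lt_ord.2 hω
  have hγκ : ∀ a < κ.ord, nxt a + Ordinal.omega0 < κ.ord := fun a ha =>
    Ordinal.isPrincipal_add_ord hω.le (hnxt.bound ha) hωκ
  obtain ⟨a, ha, a', ha', hne, J, hJ⟩ := hκ.exists_isTagEmbedding A (Tag nxt f)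
    (fun _ _ => Iff.rfl) (fun a => nxt a + Ordinal.omega0) hγκ
    (fun a => (hnxt.lt_self a).trans (hlt a)) hγlim
  obtain ⟨ξ, hξa, hclosed, hfix, ξ', hξ', hlt'⟩ := hJ.exists_critical hnxt (hγlim a) (hlt a) hne
    fun ρ => hf (nxt ρ) (hnxt.cofinal ρ)
  have hcard : ZFIsCardinal ξ.toZFSet := zfIsCardinal_toZFSet fun x hx =>
    (le_max_right _ _).trans ((hnxt.lt (hnxt.lt_self x)).le.trans (hclosed x hx).le)
  obtain ⟨hξe, hbad⟩ := hext ξ (hξa.trans_lt ha) hcard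
  have henxt : e ξ < nxt ξ := (le_max_left _ _).trans_lt (hnxt.lt (hnxt.lt_self ξ))
  have heγ : e ξ < nxt a + Ordinal.omega0 := henxt.trans ((hnxt.mono hξa).trans_lt (hlt a))
  obtain ⟨z, hz⟩ := hJ.exists_map_vonNeumann heγ
  have hzγ : z < nxt a' + Ordinal.omega0 := by
    have := hJ.rank_lt (x := ZFSet.vonNeumann (e ξ)) (by simpa using heγ)
    rwa [hz, ZFSet.rank_vonNeumann] at this
  exact hbad z (hzγ.trans (hγκ a' ha'))
    (hJ.extWitness (hγlim a) hfix hξ' hξe (henxt.trans hlt') heγ hz)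
end

section
/- The following are equivalent: (1) Vopěnka's Principle: for every proper class C of L_std-structures there are distinct M, N ∈ C and an L_std-elementary embedding j : M → N; (2) for every proper class A there is an A-extendible cardinal; (3) for every proper class B of ordinal L_std-structures there exist M, N ∈ B whose domains have different cardinalities and an L_std-elementary embedding j : M → N. -/
open FirstOrder

universe u

/-- A class of sets (i.e. a predicate on ZFC sets) is a proper class if it is not coextensive
with any set. -/
def IsProperClass (A : Set ZFSet.{u}) : Prop :=
  ¬∃ a : ZFSet.{u}, a.toSet = A

/-- Vopěnka's Principle: for every proper class `C` of `L_std`-structures there are distinct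
`M ≠ N` in `C` such that there is an `L_std`-elementary embedding from `M` into `N`. -/
def VopenkaPrinciple : Prop :=
  ∀ C : Set ZFSet.{u}, IsProperClass C → (∀ x ∈ C, IsLStdCode x) →
    ∃ M ∈ C, ∃ N ∈ C, M ≠ N ∧ ElemEmbeddable M N

/-- `α` is `η`-extendible for the class `A`: there are an ordinal `ζ` and an elementary
embedding `j : ⟨V_η, ∈, A ∩ V_η⟩ → ⟨V_ζ, ∈, A ∩ V_ζ⟩` with critical point `α` and `j α > η`. -/
def EtaExtendibleFor (A : Set ZFSet.{u}) (α η : ZFSet.{u}) : Prop :=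
  ∃ ζ : ZFSet.{u}, ζ.IsOrdinal ∧ ExtWitness A α η ζ

/-- `α` is an `A`-extendible cardinal: `α` is a cardinal that is `η`-extendible for `A`
for every ordinal `η > α`. -/
def AExtendible (A : Set ZFSet.{u}) (α : ZFSet.{u}) : Prop :=
  ZFIsCardinal α ∧ ∀ η : ZFSet.{u}, η.IsOrdinal → α ∈ η → EtaExtendibleFor A α η

/-- There is an `L_std`-elementary embedding from the structure coded by `S` into the structure
coded by `T`, where the domains of the two structures have different cardinalities. -/
def ElemEmbeddableDiffCard (S T : ZFSet.{u}) : Prop :=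
  ∃ M E R N E' R' : ZFSet.{u}, S = M.pair (E.pair R) ∧ T = N.pair (E'.pair R') ∧
    Cardinal.mk ↥M.toSet ≠ Cardinal.mk ↥N.toSet ∧
    letI := codedStructure M E R
    letI := codedStructure N E' R'
    Nonempty (↥M.toSet ↪ₑ[LStd] ↥N.toSet)

open FirstOrder.Language
open scoped ZFSet

/-- The binary relation symbol `ε` of `L_std`. -/
def epsSymbol : LStd.Relations 2 := LStdRel.eps

/-- The unary relation symbol `R` of `L_std`. -/
def rSymbol : LStd.Relations 1 := LStdRel.r

/-- `v` presents the `L_std`-structure `X` as a transitive collection of sets, with `ε`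
interpreted as membership and `R` as the trace of the class `A`. -/
structure IsTransModel_s5 (X : Type*) [LStd.Structure X] (v : X → ZFSet.{u}) (A : Set ZFSet.{u}) :
    Prop where
  inj : Function.Injective v
  trans : ∀ x, ∀ z ∈ v x, ∃ y, v y = z
  eps : ∀ a : Fin 2 → X, Structure.RelMap epsSymbol a ↔ v (a 0) ∈ v (a 1)
  r : ∀ a : Fin 1 → X, Structure.RelMap rSymbol a ↔ v (a 0) ∈ A

/-- The formula expressing that `x₀` is the unordered pair `{x₁, x₂}`. -/
def unorderedPairFormula : LStd.Formula (Fin 3) :=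
  ((epsSymbol.boundedFormula₂ (&0) (Term.var (Sum.inl 0)) :
      LStd.BoundedFormula (Fin 3) 1).iff
    ((Term.bdEqual (&0) (Term.var (Sum.inl 1))) ⊔ (Term.bdEqual (&0) (Term.var (Sum.inl 2))))).all

/-- The formula expressing that `x₀` is empty. -/
def emptyFormula : LStd.Formula (Fin 1) :=
  ((epsSymbol.boundedFormula₂ (&0) (Term.var (Sum.inl 0)) :
      LStd.BoundedFormula (Fin 1) 1).not).all

namespace IsTransModel_s5

variable {X Y : Type*} [LStd.Structure X] [LStd.Structure Y] {v : X → ZFSet.{u}}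
  {w : Y → ZFSet.{u}} {A B : Set ZFSet.{u}}

theorem realize_unorderedPair (hX : IsTransModel_s5 X v A) (a : Fin 3 → X) :
    unorderedPairFormula.Realize a ↔ v (a 0) = {v (a 1), v (a 2)} := by
  have h : unorderedPairFormula.Realize a ↔ ∀ z, v z ∈ v (a 0) ↔ z = a 1 ∨ z = a 2 := by
    simp [unorderedPairFormula, Formula.Realize, BoundedFormula.realize_all,
      BoundedFormula.realize_rel₂, hX.eps, Fin.snoc]
  rw [h, ZFSet.ext_iff]
  constructor
  · intro h z
    rw [ZFSet.mem_pair]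
    constructor
    · intro hz
      obtain ⟨y, rfl⟩ := hX.trans _ _ hz
      exact ((h y).1 hz).imp (congrArg v) (congrArg v)
    · rintro (rfl | rfl)
      · exact (h _).2 (Or.inl rfl)
      · exact (h _).2 (Or.inr rfl)
  · intro h z
    rw [h, ZFSet.mem_pair, hX.inj.eq_iff, hX.inj.eq_iff]

theorem realize_empty (hX : IsTransModel_s5 X v A) (a : Fin 1 → X) :
    emptyFormula.Realize a ↔ v (a 0) = ∅ := by
  have h : emptyFormula.Realize a ↔ ∀ z, v z ∉ v (a 0) := by
    simp [emptyFormula, Formula.Realize, BoundedFormula.realize_all,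
      BoundedFormula.realize_rel₂, hX.eps, Fin.snoc]
  rw [h, ZFSet.eq_empty]
  refine ⟨fun h z hz => ?_, fun h z => h _⟩
  obtain ⟨y, rfl⟩ := hX.trans _ _ hz
  exact h y hz

theorem map_mem_s5 (hX : IsTransModel_s5 X v A) (hY : IsTransModel_s5 Y w B) (j : X ↪ₑ[LStd] Y) (x y : X) :
    w (j x) ∈ w (j y) ↔ v x ∈ v y := by
  have := j.map_rel epsSymbol ![x, y]
  rwa [hX.eps, hY.eps] at this

theorem map_r (hX : IsTransModel_s5 X v A) (hY : IsTransModel_s5 Y w B) (j : X ↪ₑ[LStd] Y) (x : X) :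
    w (j x) ∈ B ↔ v x ∈ A := by
  have := j.map_rel rSymbol ![x]
  rwa [hX.r, hY.r] at this

theorem map_unorderedPair (hX : IsTransModel_s5 X v A) (hY : IsTransModel_s5 Y w B) (j : X ↪ₑ[LStd] Y)
    {p x y : X} (h : v p = {v x, v y}) : w (j p) = {w (j x), w (j y)} := by
  have := j.map_formula unorderedPairFormula ![p, x, y]
  rw [hX.realize_unorderedPair, hY.realize_unorderedPair] at this
  exact this.2 h

theorem map_empty_s5 (hX : IsTransModel_s5 X v A) (hY : IsTransModel_s5 Y w B) (j : X ↪ₑ[LStd] Y)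
    {x : X} (h : v x = ∅) : w (j x) = ∅ := by
  have := j.map_formula emptyFormula ![x]
  rw [hX.realize_empty, hY.realize_empty] at this
  exact this.2 h

end IsTransModel_s5

/-- The natural numbers coded as iterated singletons of the empty set. -/
def natCode : ℕ → ZFSet.{u}
  | 0 => ∅
  | n + 1 => {natCode n, natCode n}

/-- Finite lists of sets coded as iterated Kuratowski pairs. -/
def listCode : List ZFSet.{u} → ZFSet.{u}
  | [] => ∅
  | x :: l => ZFSet.pair x (listCode l)

theorem natCode_injective : Function.Injective natCode.{u} := by
  intro m
  induction m with
  | zero =>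
    rintro (_ | n) h
    · rfl
    · exact absurd h.symm (by simp [natCode, ZFSet.eq_empty])
  | succ m ih =>
    rintro (_ | n) h
    · exact absurd h (by simp [natCode, ZFSet.eq_empty])
    · simp only [natCode, ZFSet.pair_eq_singleton, ZFSet.singleton_inj] at h
      rw [ih h]

theorem pair_ne_empty (x y : ZFSet.{u}) : ZFSet.pair x y ≠ ∅ := by
  intro h
  exact ZFSet.notMem_empty {x} (h ▸ by simp [ZFSet.pair])

theorem listCode_injective : Function.Injective listCode.{u} := by
  intro l
  induction l with
  | nil =>
    rintro (_ | ⟨y, l'⟩) h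
    · rfl
    · exact absurd h.symm (pair_ne_empty _ _)
  | cons x l ih =>
    rintro (_ | ⟨y, l'⟩) h
    · exact absurd h (pair_ne_empty _ _)
    · obtain ⟨hx, hl⟩ := ZFSet.pair_inj.1 h
      rw [hx, ih hl]

/-- The class of all codes `⟨i, x₁, …, xₙ⟩` of elements `(x₁, …, xₙ)` of the relation `Q i`. -/
def codeClass (Q : ℕ → Set (List ZFSet.{u})) : Set ZFSet.{u} :=
  {x | ∃ i, ∃ l ∈ Q i, x = listCode (natCode i :: l)}

theorem listCode_mem_codeClass {Q : ℕ → Set (List ZFSet.{u})} {i : ℕ} {l : List ZFSet.{u}} :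
    listCode (natCode i :: l) ∈ codeClass Q ↔ l ∈ Q i := by
  refine ⟨?_, fun h => ⟨i, l, h, rfl⟩⟩
  rintro ⟨i', l', h, e⟩
  have := listCode_injective e
  rw [List.cons.injEq] at this
  rwa [natCode_injective this.1, this.2]

namespace IsTransModel_s5

variable {X Y : Type*} [LStd.Structure X] [LStd.Structure Y] {v : X → ZFSet.{u}}
  {w : Y → ZFSet.{u}} {A B : Set ZFSet.{u}}

theorem exists_pair (hX : IsTransModel_s5 X v A) (hY : IsTransModel_s5 Y w B)
    (hp : ∀ x y, ∃ p, v p = {v x, v y}) (j : X ↪ₑ[LStd] Y) (x y : X) :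
    ∃ p, v p = ZFSet.pair (v x) (v y) ∧ w (j p) = ZFSet.pair (w (j x)) (w (j y)) := by
  obtain ⟨a, ha⟩ := hp x x
  obtain ⟨b, hb⟩ := hp x y
  obtain ⟨p, h⟩ := hp a b
  refine ⟨p, ?_, ?_⟩
  · rw [h, ha, hb, ZFSet.pair_eq_singleton, ZFSet.pair]
  · rw [hX.map_unorderedPair hY j h, hX.map_unorderedPair hY j ha, hX.map_unorderedPair hY j hb,
      ZFSet.pair_eq_singleton, ZFSet.pair]

theorem exists_natCode (hX : IsTransModel_s5 X v A) (hY : IsTransModel_s5 Y w B)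
    (hp : ∀ x y, ∃ p, v p = {v x, v y}) (h0 : ∃ x, v x = ∅) (j : X ↪ₑ[LStd] Y) (n : ℕ) :
    ∃ p, v p = natCode n ∧ w (j p) = natCode n := by
  induction n with
  | zero =>
    obtain ⟨x, hx⟩ := h0
    exact ⟨x, hx, hX.map_empty_s5 hY j hx⟩
  | succ n ih =>
    obtain ⟨x, hx, hx'⟩ := ih
    obtain ⟨p, h⟩ := hp x x
    exact ⟨p, by rw [h, hx, natCode], by rw [hX.map_unorderedPair hY j h, hx', natCode]⟩

theorem exists_listCode (hX : IsTransModel_s5 X v A) (hY : IsTransModel_s5 Y w B)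
    (hp : ∀ x y, ∃ p, v p = {v x, v y}) (h0 : ∃ x, v x = ∅) (j : X ↪ₑ[LStd] Y) (l : List X) :
    ∃ p, v p = listCode (l.map v) ∧ w (j p) = listCode (l.map (w ∘ j)) := by
  induction l with
  | nil =>
    obtain ⟨x, hx⟩ := h0
    exact ⟨x, hx, hX.map_empty_s5 hY j hx⟩
  | cons x l ih =>
    obtain ⟨q, hq, hq'⟩ := ih
    obtain ⟨p, h, h'⟩ := hX.exists_pair hY hp j x q
    exact ⟨p, by rw [h, hq]; rfl, by rw [h', hq']; rfl⟩

/-- Elementary embeddings between transitive models preserve the coded relations. -/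
theorem map_rel {Q Q' : ℕ → Set (List ZFSet.{u})} (hX : IsTransModel_s5 X v (codeClass Q))
    (hY : IsTransModel_s5 Y w (codeClass Q')) (hp : ∀ x y, ∃ p, v p = {v x, v y})
    (h0 : ∃ x, v x = ∅) (j : X ↪ₑ[LStd] Y) (i : ℕ) (l : List X) :
    l.map (w ∘ j) ∈ Q' i ↔ l.map v ∈ Q i := by
  obtain ⟨a, ha, ha'⟩ := hX.exists_natCode hY hp h0 j i
  obtain ⟨p, h, h'⟩ := hX.exists_listCode hY hp h0 j (a :: l)
  have := hX.map_r hY j p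
  rw [h, h', List.map_cons, List.map_cons, Function.comp_apply, ha, ha', listCode_mem_codeClass,
    listCode_mem_codeClass] at this
  exact this

end IsTransModel_s5

theorem isTransModel_VStructure (η : Ordinal.{u}) (A : Set ZFSet.{u}) :
    letI := VStructure η A
    IsTransModel_s5 {x : ZFSet.{u} // x.rank < η} Subtype.val A :=
  letI := VStructure η A
  { inj := Subtype.val_injective
    trans := fun x z hz => ⟨⟨z, (ZFSet.rank_lt_of_mem hz).trans x.2⟩, rfl⟩
    eps := fun _ => Iff.rfl
    r := fun _ => Iff.rfl }

theorem isTransModel_codedStructure {M E R : ZFSet.{u}} {A : Set ZFSet.{u}}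
    (hM : M.IsTransitive) (hE : ∀ a ∈ M, ∀ b ∈ M, ZFSet.pair a b ∈ E ↔ a ∈ b)
    (hR : ∀ a ∈ M, a ∈ R ↔ a ∈ A) :
    letI := codedStructure M E R
    IsTransModel_s5 ↥M.toSet Subtype.val A :=
  letI := codedStructure M E R
  { inj := Subtype.val_injective
    trans := fun x z hz => ⟨⟨z, hM _ x.2 hz⟩, rfl⟩
    eps := fun a => hE _ (a 0).2 _ (a 1).2
    r := fun a => hR _ (a 0).2 }

/-- The satisfaction relation of the formula `p` in a family of structures indexed by ordinals. -/
def satRel (D : Ordinal.{u} → Set ZFSet.{u}) (S : ∀ ξ, LStd.Structure (D ξ))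
    (p : Σ n, LStd.Formula (Fin n)) : Set (List ZFSet.{u}) :=
  {l | ∃ ξ, ∃ x : Fin p.1 → D ξ, l = ξ.toZFSet :: List.ofFn (fun i => (x i).1) ∧
    letI := S ξ
    p.2.Realize x}

theorem mem_satRel {D : Ordinal.{u} → Set ZFSet.{u}} {S : ∀ ξ, LStd.Structure (D ξ)} {n : ℕ}
    {φ : LStd.Formula (Fin n)} {ξ : Ordinal.{u}} {y : Fin n → ZFSet.{u}} :
    ξ.toZFSet :: List.ofFn y ∈ satRel D S ⟨n, φ⟩ ↔
      ∃ x : Fin n → D ξ, (∀ i, (x i).1 = y i) ∧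
        letI := S ξ
        φ.Realize x := by
  constructor
  · rintro ⟨ξ', x, h, hx⟩
    rw [List.cons.injEq] at h
    obtain ⟨h1, h2⟩ := h
    obtain rfl := Ordinal.toZFSet_injective h1
    exact ⟨x, fun i => (congrFun (List.ofFn_injective h2) i).symm, hx⟩
  · rintro ⟨x, h, hx⟩
    exact ⟨ξ, x, by rw [funext h], hx⟩

theorem exists_elementaryEmbedding_of_satRel {D : Ordinal.{u} → Set ZFSet.{u}}
    {S : ∀ ξ, LStd.Structure (D ξ)} {X Y : Type*} {v : X → ZFSet.{u}} {w : Y → ZFSet.{u}}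
    (hv : Function.Injective v) (f : X → Y)
    (hf : ∀ p, ∀ l : List X, l.map (w ∘ f) ∈ satRel D S p ↔ l.map v ∈ satRel D S p)
    {ξ : Ordinal.{u}} {e : X} (he : v e = ξ.toZFSet) (hD : ∀ x ∈ D ξ, ∃ y, v y = x) :
    ∃ ξ' : Ordinal.{u}, w (f e) = ξ'.toZFSet ∧
      letI := S ξ
      letI := S ξ'
      ∃ j : D ξ ↪ₑ[LStd] D ξ', ∀ (x : D ξ) (y : X), v y = x.1 → (j x).1 = w (f y) := by
  have h0 : [e].map v ∈ satRel D S ⟨0, ⊤⟩ :=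
    ⟨ξ, Fin.elim0, by simp [he], by simp [Formula.Realize]⟩
  obtain ⟨ξ', _, h, _⟩ := (hf _ _).2 h0
  have he' : w (f e) = ξ'.toZFSet := by simpa using h
  refine ⟨ξ', he', ?_⟩
  let _ := S ξ
  let _ := S ξ'
  choose g hg using fun x : D ξ => hD x.1 x.2
  have key : ∀ {n : ℕ} (φ : LStd.Formula (Fin n)) (x : Fin n → D ξ),
      (∃ x' : Fin n → D ξ', (∀ i, (x' i).1 = w (f (g (x i)))) ∧ φ.Realize x') ↔ φ.Realize x := by
    intro n φ x
    have h := hf ⟨n, φ⟩ (e :: List.ofFn (fun i => g (x i)))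
    simp only [List.map_cons, List.map_ofFn, Function.comp_apply, he, he'] at h
    rw [mem_satRel, mem_satRel] at h
    refine Iff.trans h ⟨?_, fun hx => ⟨x, fun i => (hg _).symm, hx⟩⟩
    rintro ⟨x', hx', hr⟩
    have : x' = x := funext fun i => Subtype.ext ((hx' i).trans (hg _))
    rwa [← this]
  have hmem : ∀ x : D ξ, w (f (g x)) ∈ D ξ' := by
    intro x
    obtain ⟨x', hx', -⟩ := (key (n := 1) ⊤ (fun _ => x)).2 (by simp [Formula.Realize])
    exact hx' 0 ▸ (x' 0).2
  refine ⟨⟨fun x => ⟨w (f (g x)), hmem x⟩, ?_⟩, ?_⟩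
  · intro n φ x
    rw [← key φ x]
    refine ⟨fun h => ⟨_, fun i => rfl, h⟩, ?_⟩
    rintro ⟨x', hx', hr⟩
    have : x' = (fun x => ⟨w (f (g x)), hmem x⟩) ∘ x := funext fun i => Subtype.ext (hx' i)
    rwa [← this]
  · intro x y hy
    have : g x = y := hv ((hg x).trans hy.symm)
    change w (f (g x)) = _
    rw [this]

instance : Countable LStd.Symbols := by
  have h1 : ∀ l, Countable (LStd.Functions l) := fun l => inferInstanceAs (Countable Empty)
  have h2 : ∀ l, Countable (LStd.Relations l) := by
    intro l
    refine Function.Injective.countable (f := fun s : LStdRel l =>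
      match s with
      | .eps => 0
      | .r => 1) ?_
    intro a b _
    cases a <;> cases b <;> rfl
  unfold Language.Symbols
  infer_instance

theorem exists_surjective_formula :
    ∃ d : ℕ → Σ n, LStd.Formula (Fin n), Function.Surjective d :=
  haveI : Nonempty (Σ n, LStd.Formula (Fin n)) := ⟨⟨0, ⊤⟩⟩
  exists_surjective_nat _

theorem isProperClass_iff {A : Set ZFSet.{u}} : IsProperClass A ↔ ¬Small.{u} A := by
  rw [IsProperClass, not_iff_not]
  constructor
  · rintro ⟨a, rfl⟩
    exact ZFSet.small_coe a
  · intro h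
    refine ⟨ZFSet.range (Subtype.val : A → ZFSet.{u}), ?_⟩
    ext x
    exact ZFSet.mem_range.trans (by simp)

theorem isProperClass_of_injective {A : Set ZFSet.{u}} (S : Ordinal.{u} → ZFSet.{u})
    (hS : Function.Injective S) (h : ∀ ξ, S ξ ∈ A) : IsProperClass A := by
  rw [isProperClass_iff]
  intro hA
  refine not_small_ordinal.{u, u} (small_of_injective (f := fun ξ => (⟨S ξ, h ξ⟩ : A)) ?_)
  intro a b hab
  exact hS (congrArg Subtype.val hab)

theorem IsProperClass.exists_injective {A : Set ZFSet.{u}} (hA : IsProperClass A) :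
    ∃ S : Ordinal.{u} → ZFSet.{u}, Function.Injective S ∧ ∀ ξ, S ξ ∈ A := by
  rw [isProperClass_iff, Cardinal.small_iff_lift_mk_lt_univ, not_lt, Cardinal.lift_id,
    ← Cardinal.mk_ordinal] at hA
  obtain ⟨f⟩ := hA
  exact ⟨fun ξ => (f ξ).1, Subtype.val_injective.comp f.injective, fun ξ => (f ξ).2⟩

theorem exists_unorderedPair {η : Ordinal.{u}} (hη : ∀ b < η, b + 1 < η)
    (x y : {x : ZFSet.{u} // x.rank < η}) : ∃ p : {x : ZFSet.{u} // x.rank < η},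
      p.1 = {x.1, y.1} := by
  refine ⟨⟨{x.1, y.1}, ?_⟩, rfl⟩
  rw [ZFSet.rank_pair]
  exact max_lt (hη _ x.2) (hη _ y.2)

theorem vopenkaPrinciple_of_aExtendible
    (h : ∀ A : Set ZFSet.{u}, IsProperClass A → ∃ α : ZFSet.{u}, AExtendible A α) :
    VopenkaPrinciple.{u} := by
  intro C hC hcode
  obtain ⟨S, hinj, hSC⟩ := hC.exists_injective
  choose M E R hS _ _ using fun ξ => hcode _ (hSC ξ)
  obtain ⟨d, hd⟩ := exists_surjective_formula
  let D : Ordinal.{u} → Set ZFSet.{u} := fun ξ => (M ξ).toSet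
  let str : ∀ ξ, LStd.Structure (D ξ) := fun ξ => codedStructure (M ξ) (E ξ) (R ξ)
  let Q : ℕ → Set (List ZFSet.{u}) := fun i => satRel D str (d i)
  obtain ⟨i₀, hi₀⟩ := hd ⟨0, ⊤⟩
  have hproper : IsProperClass (codeClass Q) := by
    refine isProperClass_of_injective (fun ξ => listCode [natCode i₀, ξ.toZFSet]) ?_ ?_
    · intro a b hab
      have := listCode_injective hab
      simp only [List.cons.injEq, true_and, and_true] at this
      exact Ordinal.toZFSet_injective this
    · intro ξ
      rw [listCode_mem_codeClass]
      change _ ∈ satRel D str (d i₀)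
      rw [hi₀]
      exact ⟨ξ, Fin.elim0, by simp, by simp [Formula.Realize]⟩
  obtain ⟨α, hα, hext⟩ := h _ hproper
  obtain ⟨a, rfl⟩ := ZFSet.isOrdinal_iff_mem_range_toZFSet.1 hα.1
  set η : Ordinal.{u} := max a (M a).rank + Ordinal.omega0 with hη
  have hlt : max a (M a).rank < η := by
    rw [hη]
    exact lt_add_of_pos_right _ Ordinal.omega0_pos
  have hlim : ∀ b < η, b + 1 < η := fun b hb =>
    (Ordinal.isSuccLimit_add _ Ordinal.isSuccLimit_omega0).add_one_lt hb
  obtain ⟨ζ, -, hw⟩ := hext η.toZFSet (ZFSet.isOrdinal_toZFSet _)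
    (Ordinal.toZFSet_mem_toZFSet_iff.2 ((le_max_left _ _).trans_lt hlt))
  unfold ExtWitness at hw
  rw [Ordinal.rank_toZFSet] at hw
  let _ := VStructure η (codeClass Q)
  let _ := VStructure ζ.rank (codeClass Q)
  obtain ⟨j, -, hj⟩ := hw
  have ha : a.toZFSet.rank < η := by
    rw [Ordinal.rank_toZFSet]
    exact (le_max_left _ _).trans_lt hlt
  have hne := (hj ha).1
  have hX := isTransModel_VStructure η (codeClass Q)
  have hY := isTransModel_VStructure ζ.rank (codeClass Q)
  have hrel : ∀ p, ∀ l : List {x : ZFSet.{u} // x.rank < η},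
      l.map (Subtype.val ∘ j) ∈ satRel D str p ↔ l.map Subtype.val ∈ satRel D str p := by
    intro p l
    obtain ⟨i, rfl⟩ := hd p
    exact hX.map_rel (Q := Q) (Q' := Q) hY (exists_unorderedPair hlim)
      ⟨⟨∅, by rw [ZFSet.rank_empty]; exact bot_le.trans_lt hlt⟩, rfl⟩ j i l
  obtain ⟨b, hb, hemb⟩ := exists_elementaryEmbedding_of_satRel Subtype.val_injective j hrel
    (ξ := a) (e := ⟨_, ha⟩) rfl (fun x hx => ⟨⟨x,
      (ZFSet.rank_lt_of_mem (show x ∈ M a from hx)).trans ((le_max_right _ _).trans_lt hlt)⟩, rfl⟩)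
  obtain ⟨k, -⟩ := hemb
  refine ⟨S a, hSC a, S b, hSC b, ?_, M a, E a, R a, M b, E b, R b, hS a, hS b, ⟨k⟩⟩
  intro hab
  exact hne (by rw [hb, hinj hab])

theorem ElemEmbeddable.trans {S T U : ZFSet.{u}} (h₁ : ElemEmbeddable S T)
    (h₂ : ElemEmbeddable T U) : ElemEmbeddable S U := by
  obtain ⟨M, E, R, N, E', R', rfl, rfl, ⟨j⟩⟩ := h₁
  obtain ⟨N₁, E₁, R₁, P, E₂, R₂, h, rfl, ⟨k⟩⟩ := h₂
  obtain ⟨rfl, h'⟩ := ZFSet.pair_inj.1 h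
  obtain ⟨rfl, rfl⟩ := ZFSet.pair_inj.1 h'
  let _ := codedStructure M E R
  let _ := codedStructure N E' R'
  let _ := codedStructure P E₂ R₂
  exact ⟨M, E, R, P, E₂, R₂, rfl, rfl, ⟨k.comp j⟩⟩

theorem IsLStdCode.exists_ordinal_copy {S : ZFSet.{u}} (hS : IsLStdCode S) :
    ∃ T, IsOrdinalLStdCode T ∧ ElemEmbeddable S T ∧ ElemEmbeddable T S := by
  obtain ⟨M, E, R, rfl, -, -⟩ := hS
  set O : ZFSet.{u} := M.card.ord.toZFSet with hO
  have hcard : M.card = O.card := by rw [hO, Ordinal.card_toZFSet, Cardinal.card_ord]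
  obtain ⟨e₀⟩ := Cardinal.eq.1 hcard
  let e : ↥M.toSet ≃ ↥O.toSet := (equivShrink M).trans (e₀.trans (equivShrink O).symm)
  let E' : ZFSet.{u} := ZFSet.sep
    (fun p => ∃ a b : ↥M.toSet, p = ZFSet.pair (e a).1 (e b).1 ∧ ZFSet.pair a.1 b.1 ∈ E)
    (ZFSet.prod O O)
  let R' : ZFSet.{u} := ZFSet.sep (fun x => ∃ a : ↥M.toSet, x = (e a).1 ∧ a.1 ∈ R) O
  have hE : ∀ a b : ↥M.toSet, ZFSet.pair (e a).1 (e b).1 ∈ E' ↔ ZFSet.pair a.1 b.1 ∈ E := by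
    intro a b
    rw [ZFSet.mem_sep, ZFSet.pair_mem_prod]
    constructor
    · rintro ⟨-, a', b', h, h'⟩
      obtain ⟨h1, h2⟩ := ZFSet.pair_inj.1 h
      rwa [e.injective (Subtype.ext h1), e.injective (Subtype.ext h2)]
    · exact fun h => ⟨⟨(e a).2, (e b).2⟩, a, b, rfl, h⟩
  have hR : ∀ a : ↥M.toSet, (e a).1 ∈ R' ↔ a.1 ∈ R := by
    intro a
    rw [ZFSet.mem_sep]
    constructor
    · rintro ⟨-, a', h, h'⟩
      rwa [e.injective (Subtype.ext h)]
    · exact fun h => ⟨(e a).2, a, rfl, h⟩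
  let _ := codedStructure M E R
  let _ := codedStructure O E' R'
  let f : ↥M.toSet ≃[LStd] ↥O.toSet :=
    { e with
      map_fun' := fun g _ => g.elim
      map_rel' := fun s x => by
        cases s with
        | eps => exact hE _ _
        | r => exact hR _ }
  refine ⟨O.pair (E'.pair R'), ⟨O, E', R', rfl, ZFSet.isOrdinal_toZFSet _, ?_, ZFSet.sep_subset⟩,
    ⟨M, E, R, O, E', R', rfl, rfl, ⟨f.toElementaryEmbedding⟩⟩,
    ⟨O, E', R', M, E, R, rfl, rfl, ⟨f.symm.toElementaryEmbedding⟩⟩⟩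
  intro p hp
  exact ZFSet.mem_prod.1 (ZFSet.sep_subset hp)

theorem vopenkaPrinciple_of_ordinal
    (h : ∀ B : Set ZFSet.{u}, IsProperClass B → (∀ x ∈ B, IsOrdinalLStdCode x) →
      ∃ M ∈ B, ∃ N ∈ B, ElemEmbeddableDiffCard M N) : VopenkaPrinciple.{u} := by
  intro C hC hcode
  by_contra! hcon
  choose T hT hST hTS using fun S : C => (hcode S.1 S.2).exists_ordinal_copy
  have hinj : Function.Injective T := by
    intro S S' hSS
    by_contra hne
    refine hcon S.1 S.2 S'.1 S'.2 (fun h => hne (Subtype.ext h)) ((hST S).trans ?_)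
    rw [hSS]
    exact hTS S'
  have hproper : IsProperClass (Set.range T) := by
    rw [isProperClass_iff] at hC ⊢
    intro hsmall
    exact hC (small_of_injective (β := Set.range T) (f := Set.rangeFactorization T)
      (Set.rangeFactorization_injective.2 hinj))
  obtain ⟨_, ⟨S, rfl⟩, _, ⟨S', rfl⟩, M, E, R, N, E', R', h1, h2, hne, hemb⟩ :=
    h _ hproper (by rintro _ ⟨S, rfl⟩; exact hT S)
  refine hcon S.1 S.2 S'.1 S'.2 ?_
    (((hST S).trans ⟨M, E, R, N, E', R', h1, h2, hemb⟩).trans (hTS S'))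
  intro hSS
  obtain rfl : S = S' := Subtype.ext hSS
  exact hne (by rw [(ZFSet.pair_inj.1 (h1.symm.trans h2)).1])

theorem small_of_small_fibers {α : Type*} {β : Type*} (c : α → β) [Small.{u} (Set.range c)]
    (h : ∀ a, Small.{u} {x // c x = c a}) : Small.{u} α := by
  have : ∀ y : Set.range c, Small.{u} {x // c x = y.1} := by
    rintro ⟨_, a, rfl⟩
    exact h a
  refine small_of_injective
    (f := fun a => (⟨⟨c a, a, rfl⟩, ⟨a, rfl⟩⟩ : Σ y : Set.range c, {x // c x = y.1})) ?_
  intro a b hab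
  simp only [Sigma.mk.injEq] at hab
  obtain ⟨h1, h2⟩ := hab
  grind

theorem VopenkaPrinciple.ordinal (h : VopenkaPrinciple.{u}) (B : Set ZFSet.{u})
    (hB : IsProperClass B) (hcode : ∀ x ∈ B, IsOrdinalLStdCode x) :
    ∃ M ∈ B, ∃ N ∈ B, ElemEmbeddableDiffCard M N := by
  choose M E R hS hM hE hR using fun x : B => hcode x.1 x.2
  let c : B → Cardinal.{u + 1} := fun x => Cardinal.mk ↥(M x).toSet
  have hfib : ∀ a, Small.{u} {x // c x = c a} := by
    intro a
    set V : ZFSet.{u} := V_ (Order.succ (M a).card).ord with hV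
    let W : ZFSet.{u} := V.prod ((V.prod V).powerset.prod V.powerset)
    have hmem : ∀ x, c x = c a → x.1 ∈ W := by
      intro x hx
      have hcard : (M x).card = (M a).card := by
        apply Cardinal.lift_injective.{u + 1, u}
        rw [← ZFSet.cardinalMk_coe_sort, ← ZFSet.cardinalMk_coe_sort]
        exact hx
      have hMV : M x ∈ V := by
        rw [hV, ZFSet.mem_vonNeumann, Cardinal.lt_ord, ← hcard, Order.lt_succ_iff,
          ← Ordinal.card_toZFSet, (hM x).toZFSet_rank_eq]
      have hsub : M x ⊆ V := ZFSet.isTransitive_vonNeumann _ _ hMV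
      rw [hS x, ZFSet.pair_mem_prod, ZFSet.pair_mem_prod, ZFSet.mem_powerset, ZFSet.mem_powerset]
      refine ⟨hMV, fun p hp => ?_, fun y hy => hsub (hR x hy)⟩
      obtain ⟨y, hy, z, hz, rfl⟩ := hE x p hp
      exact ZFSet.pair_mem_prod.2 ⟨hsub hy, hsub hz⟩
    have hsmall : Small.{u} W := ZFSet.small_coe W
    refine small_of_injective (f := fun x : {x // c x = c a} => (⟨x.1.1, hmem x.1 x.2⟩ : W)) ?_
    intro x y hxy
    exact Subtype.ext (Subtype.ext (Subtype.mk.inj hxy))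
  have hrange : ¬Small.{u} (Set.range c) := fun hsmall =>
    isProperClass_iff.1 hB (small_of_small_fibers c hfib)
  choose g hg using fun y : Set.range c => y.2
  have hproper : IsProperClass (Set.range fun y => (g y).1) := by
    rw [isProperClass_iff]
    intro hsmall
    refine hrange (small_of_injective (β := Set.range fun y => (g y).1)
      (f := Set.rangeFactorization _) (Set.rangeFactorization_injective.2 ?_))
    intro y z hyz
    have : g y = g z := Subtype.ext hyz
    exact Subtype.ext (by rw [← hg y, this, hg z])
  obtain ⟨_, ⟨y, rfl⟩, _, ⟨z, rfl⟩, hne, N, F, P, N', F', P', h1, h2, hemb⟩ := h _ hproper (by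
    rintro _ ⟨y, rfl⟩
    exact ⟨_, _, _, hS (g y), hE _, hR _⟩)
  refine ⟨_, (g y).2, _, (g z).2, N, F, P, N', F', P', h1, h2, ?_, hemb⟩
  intro hcard
  have hN : N = M (g y) := (ZFSet.pair_inj.1 (h1.symm.trans (hS (g y)))).1
  have hN' : N' = M (g z) := (ZFSet.pair_inj.1 (h2.symm.trans (hS (g z)))).1
  rw [hN, hN'] at hcard
  have : y = z := Subtype.ext (by rw [← hg y, ← hg z]; exact hcard)
  exact hne (by rw [this])

theorem VopenkaPrinciple.exists_map (h : VopenkaPrinciple.{u}) (B : Ordinal.{u} → Ordinal.{u})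
    (hB : ∀ γ, γ < B γ) (hlim : ∀ γ, ∀ b < B γ, b + 1 < B γ) {I : Type*} [Countable I]
    [Nonempty I] (Q : I → Set (List ZFSet.{u})) :
    ∃ γ δ, γ ≠ δ ∧ ∃ f : {x : ZFSet.{u} // x.rank < B γ} → {x : ZFSet.{u} // x.rank < B δ},
      (∀ x y, (f x).1 ∈ (f y).1 ↔ x.1 ∈ y.1) ∧
      (∀ i, ∀ l : List {x : ZFSet.{u} // x.rank < B γ},
        l.map (Subtype.val ∘ f) ∈ Q i ↔ l.map Subtype.val ∈ Q i) ∧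
      ∀ x, x.1 = γ.toZFSet → (f x).1 = δ.toZFSet := by
  obtain ⟨d, hd⟩ := exists_surjective_nat I
  let Q' : Ordinal.{u} → ℕ → Set (List ZFSet.{u}) := fun γ i =>
    match i with
    | 0 => {[γ.toZFSet]}
    | i + 1 => Q (d i)
  let V : Ordinal.{u} → ZFSet.{u} := fun γ => V_ (B γ)
  have hV : ∀ γ x, x ∈ V γ ↔ x.rank < B γ := fun γ x => ZFSet.mem_vonNeumann
  let E : Ordinal.{u} → ZFSet.{u} := fun γ =>
    ZFSet.sep (fun p => ∃ a b, p = ZFSet.pair a b ∧ a ∈ b) ((V γ).prod (V γ))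
  let R : Ordinal.{u} → ZFSet.{u} := fun γ => ZFSet.sep (· ∈ codeClass (Q' γ)) (V γ)
  have hE : ∀ γ, ∀ a ∈ V γ, ∀ b ∈ V γ, ZFSet.pair a b ∈ E γ ↔ a ∈ b := by
    intro γ a ha b hb
    rw [ZFSet.mem_sep, ZFSet.pair_mem_prod]
    constructor
    · rintro ⟨-, a', b', h, hab⟩
      obtain ⟨rfl, rfl⟩ := ZFSet.pair_inj.1 h
      exact hab
    · exact fun hab => ⟨⟨ha, hb⟩, a, b, rfl, hab⟩
  have hR : ∀ γ, ∀ a ∈ V γ, a ∈ R γ ↔ a ∈ codeClass (Q' γ) := fun γ a ha => by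
    rw [ZFSet.mem_sep]
    exact and_iff_right ha
  let S : Ordinal.{u} → ZFSet.{u} := fun γ => (V γ).pair ((E γ).pair (R γ))
  have hS : Function.Injective S := by
    intro γ δ hγδ
    have hRR : R γ = R δ := (ZFSet.pair_inj.1 (ZFSet.pair_inj.1 hγδ).2).2
    have hmem : listCode [natCode 0, γ.toZFSet] ∈ R γ := by
      refine ZFSet.mem_sep.2 ⟨(hV _ _).2 ?_, listCode_mem_codeClass.2 rfl⟩
      have hpos := hlim γ _ (bot_le.trans_lt (hB γ))
      have hpair : ∀ x y : ZFSet.{u}, x.rank < B γ → y.rank < B γ → (x.pair y).rank < B γ := by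
        intro x y hx hy
        rw [ZFSet.pair, ZFSet.rank_pair, ZFSet.rank_pair, ZFSet.rank_singleton]
        exact max_lt (hlim _ _ (hlim _ _ hx)) (hlim _ _ (max_lt (hlim _ _ hx) (hlim _ _ hy)))
      have hempty : (∅ : ZFSet.{u}).rank < B γ := by
        rw [ZFSet.rank_empty]
        exact bot_le.trans_lt (hB γ)
      exact hpair _ _ hempty (hpair _ _ (by rw [Ordinal.rank_toZFSet]; exact hB γ) hempty)
    rw [hRR] at hmem
    have := listCode_mem_codeClass.1 (ZFSet.mem_sep.1 hmem).2
    exact Ordinal.toZFSet_injective (List.singleton_inj.1 this)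
  obtain ⟨_, ⟨γ, rfl⟩, _, ⟨δ, rfl⟩, hne, M, F, P, N, F', P', h1, h2, ⟨j⟩⟩ :=
    h (Set.range S) (isProperClass_of_injective S hS fun γ => ⟨γ, rfl⟩) (by
      rintro _ ⟨γ, rfl⟩
      exact ⟨V γ, E γ, R γ, rfl, fun p hp => ZFSet.mem_prod.1 (ZFSet.sep_subset hp),
        ZFSet.sep_subset⟩)
  obtain ⟨rfl, h1'⟩ := ZFSet.pair_inj.1 h1
  obtain ⟨rfl, rfl⟩ := ZFSet.pair_inj.1 h1'
  obtain ⟨rfl, h2'⟩ := ZFSet.pair_inj.1 h2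
  obtain ⟨rfl, rfl⟩ := ZFSet.pair_inj.1 h2'
  let _ := codedStructure (V γ) (E γ) (R γ)
  let _ := codedStructure (V δ) (E δ) (R δ)
  have hX := isTransModel_codedStructure (ZFSet.isTransitive_vonNeumann _) (hE γ) (hR γ)
  have hY := isTransModel_codedStructure (ZFSet.isTransitive_vonNeumann _) (hE δ) (hR δ)
  have hp : ∀ x y : ↥(V γ).toSet, ∃ p : ↥(V γ).toSet, p.1 = {x.1, y.1} := by
    intro x y
    obtain ⟨p, hp⟩ := exists_unorderedPair (hlim γ) ⟨x.1, (hV _ _).1 x.2⟩ ⟨y.1, (hV _ _).1 y.2⟩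
    exact ⟨⟨p.1, (hV _ _).2 p.2⟩, hp⟩
  have h0 : ∃ x : ↥(V γ).toSet, x.1 = ∅ :=
    ⟨⟨∅, (hV _ _).2 (by rw [ZFSet.rank_empty]; exact bot_le.trans_lt (hB γ))⟩, rfl⟩
  let g : {x : ZFSet.{u} // x.rank < B γ} → ↥(V γ).toSet := fun x => ⟨x.1, (hV _ _).2 x.2⟩
  have hrel := hX.map_rel (Q := Q' γ) (Q' := Q' δ) hY hp h0 j
  refine ⟨γ, δ, fun h => hne (by rw [h]), fun x => ⟨(j (g x)).1, (hV _ _).1 (j (g x)).2⟩,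
    fun x y => hX.map_mem_s5 hY j (g x) (g y), ?_, ?_⟩
  · intro i l
    obtain ⟨i, rfl⟩ := hd i
    have := hrel (i + 1) (l.map g)
    rwa [List.map_map, List.map_map] at this
  · intro x hx
    have := (hrel 0 [g x]).2 (congrArg (fun z => [z]) hx)
    exact List.singleton_inj.1 this

/-- The sequence `s` is cofinal in the ordinal `σ`. -/
def IsCofinalSeq (σ : Ordinal.{u}) (s : ℕ → Ordinal.{u}) : Prop :=
  (∀ n, s n < σ) ∧ ∀ a < σ, ∃ n, a ≤ s n

theorem exists_ladderSystem : ∃ c : ℕ → Ordinal.{u} → Ordinal.{u},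
    ∀ σ, (c 0 σ < σ ∨ ∃ s, IsCofinalSeq σ s) → IsCofinalSeq σ (c · σ) := by
  have : ∀ σ : Ordinal.{u}, ∃ s : ℕ → Ordinal.{u},
      (s 0 < σ ∨ ∃ t, IsCofinalSeq σ t) → IsCofinalSeq σ s := by
    intro σ
    by_cases h : ∃ t, IsCofinalSeq σ t
    · exact h.imp fun t ht _ => ht
    · exact ⟨fun _ => σ, by simp [h]⟩
  choose c hc using this
  exact ⟨fun n σ => c σ n, hc⟩

/-- An order embedding that respects a ladder system has no fixed point above a moved point. -/
theorem map_ne_of_lt_map {c : ℕ → Ordinal.{u} → Ordinal.{u}}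
    (hc : ∀ σ, (c 0 σ < σ ∨ ∃ s, IsCofinalSeq σ s) → IsCofinalSeq σ (c · σ))
    {J : Ordinal.{u} → Ordinal.{u}} {b : Ordinal.{u}}
    (hJ : ∀ σ < b, ∀ τ < b, J σ < J τ ↔ σ < τ)
    (hJc : ∀ n, ∀ σ < b, c n σ < b → J (c n σ) = c n (J σ)) {κ θ : Ordinal.{u}}
    (hκ : κ < J κ) (hκθ : κ ≤ θ) (hθ : θ < b) : J θ ≠ θ := by
  intro hfix
  have hκθ' : κ < θ := by
    refine lt_of_le_of_ne hκθ ?_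
    rintro rfl
    exact hκ.ne' hfix
  let s : ℕ → Ordinal.{u} := fun n => J^[n] κ
  have hs : ∀ n, s (n + 1) = J (s n) := fun n => Function.iterate_succ_apply' J n κ
  have hsθ : ∀ n, s n < θ := by
    intro n
    induction n with
    | zero => exact hκθ'
    | succ n ih =>
      rw [hs, ← hfix]
      exact (hJ _ (ih.trans hθ) _ hθ).2 ih
  have hsb : ∀ n, s n < b := fun n => (hsθ n).trans hθ
  have hlt : ∀ n, s n < s (n + 1) := by
    intro n
    induction n with
    | zero => exact hκ
    | succ n ih =>
      rw [hs, hs (n + 1)]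
      exact (hJ _ (hsb _) _ (hsb _)).2 ih
  let σ : Ordinal.{u} := ⨆ n, s n
  have hsle : ∀ n, s n ≤ σ := fun n => Ordinal.le_iSup s n
  have hsσ : ∀ n, s n < σ := fun n => (hlt n).trans_le (hsle _)
  have hσs : ∀ a < σ, ∃ n, a < s n := fun a ha => Ordinal.lt_iSup_iff.1 ha
  have hσb : σ < b := (Ordinal.iSup_le fun n => (hsθ n).le).trans_lt hθ
  have hσ : IsCofinalSeq σ (c · σ) :=
    hc σ (.inr ⟨s, hsσ, fun a ha => (hσs a ha).imp fun _ => le_of_lt⟩)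
  have hcb : ∀ n, c n σ < b := fun n => (hσ.1 n).trans hσb
  have hJσ : IsCofinalSeq (J σ) (c · (J σ)) := by
    refine hc _ (.inl ?_)
    rw [← hJc 0 σ hσb (hcb 0)]
    exact (hJ _ (hcb 0) _ hσb).2 (hσ.1 0)
  have hfixσ : J σ = σ := by
    refine le_antisymm (not_lt.1 fun hlt => ?_) (Ordinal.iSup_le fun n => ?_)
    · obtain ⟨n, hn⟩ := hJσ.2 σ hlt
      obtain ⟨m, hm⟩ := hσs _ (hσ.1 n)
      change σ ≤ c n (J σ) at hn
      rw [← hJc n σ hσb (hcb n)] at hn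
      have := (hJ _ (hcb n) _ (hsb m)).2 hm
      rw [← hs] at this
      exact (hn.trans_lt this).not_ge (hsle _)
    · refine (hlt n).le.trans ?_
      rw [hs]
      exact ((hJ _ (hsb n) _ hσb).2 (hsσ n)).le
  obtain ⟨n, hn⟩ := hσ.2 κ (hsσ 0)
  have hτ : J (c n σ) = c n σ := by rw [hJc n σ hσb (hcb n), hfixσ]
  have hle : ∀ m, s m ≤ c n σ := by
    intro m
    induction m with
    | zero => exact hn
    | succ m ih =>
      rw [hs, ← hτ]
      exact not_lt.1 fun h => ih.not_gt ((hJ _ (hcb n) _ (hsb m)).1 h)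
  obtain ⟨m, hm⟩ := hσs _ (hσ.1 n)
  exact (hle m).not_gt hm

/-- The critical point of an order embedding that respects a ladder system and an ordinal function
`g` is closed under `g`, and so is its image. -/
theorem exists_critical_point {c : ℕ → Ordinal.{u} → Ordinal.{u}}
    (hc : ∀ σ, (c 0 σ < σ ∨ ∃ s, IsCofinalSeq σ s) → IsCofinalSeq σ (c · σ))
    {J g w : Ordinal.{u} → Ordinal.{u}} {b : Ordinal.{u}}
    (hw : ∀ a, IsLeast {x | a ≤ x ∨ a ≤ g x} (w a))
    (hJ : ∀ σ < b, ∀ τ < b, J σ < J τ ↔ σ < τ)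
    (hJc : ∀ n, ∀ σ < b, c n σ < b → J (c n σ) = c n (J σ))
    (hJw : ∀ σ < b, w σ < b → J (w σ) = w (J σ))
    (hJg : ∀ σ < b, g σ < b → J (g σ) = g (J σ))
    (hg : ∀ a < b, g a < b) {γ : Ordinal.{u}} (hγ : γ < b) (hne : J γ ≠ γ) :
    ∃ κ < b, (∀ a < κ, J a = a) ∧ (∀ a < κ, g a < κ) ∧ κ < J κ ∧ g κ < J κ := by
  obtain ⟨κ, hκ, hmin⟩ := WellFounded.has_min (wellFounded_lt (α := Ordinal.{u}))
    {a | J a ≠ a} ⟨γ, hne⟩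
  have hfix : ∀ a < κ, J a = a := fun a ha => by_contra fun h => hmin a h ha
  have hκb : κ < b := (not_lt.1 (hmin γ hne)).trans_lt hγ
  have hlt : κ < J κ := by
    refine lt_of_le_of_ne (not_lt.1 fun h => ?_) (Ne.symm hκ)
    have := (hJ _ (h.trans hκb) _ hκb).2 h
    rw [hfix _ h] at this
    exact lt_irrefl _ this
  have hclosed : ∀ a < κ, g a < κ := by
    intro a ha
    by_contra! hle
    have hab := ha.trans hκb
    refine map_ne_of_lt_map hc hJ hJc hlt hle (hg a hab) ?_
    rw [hJg a hab (hg a hab), hfix a ha]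
  have hwκ : w κ = κ := by
    refine le_antisymm ((hw κ).2 (.inl le_rfl)) (not_lt.1 fun h => ?_)
    exact (hw κ).1.elim (fun h' => h.not_ge h') (fun h' => (hclosed _ h).not_ge h')
  refine ⟨κ, hκb, hfix, hclosed, hlt, not_le.1 fun h => ?_⟩
  have h1 := (hw (J κ)).2 (show κ ∈ {x | J κ ≤ x ∨ J κ ≤ g x} from .inr h)
  rw [← hJw κ hκb (hwκ.symm ▸ hκb), hwκ] at h1
  exact h1.not_gt hlt

theorem exists_closed_gt (g : Ordinal.{u} → Ordinal.{u}) (γ : Ordinal.{u}) :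
    ∃ b, γ < b ∧ ∀ a < b, g a < b := by
  let m : Ordinal.{u} → Ordinal.{u} := fun o => ⨆ a : Set.Iio o, g a + 1
  refine ⟨Ordinal.nfp m (γ + 1), ?_, fun a ha => ?_⟩
  · exact Ordinal.lt_nfp_iff.2 ⟨0, lt_add_one _⟩
  · obtain ⟨n, hn⟩ := Ordinal.lt_nfp_iff.1 ha
    refine Ordinal.lt_nfp_iff.2 ⟨n + 1, ?_⟩
    rw [Function.iterate_succ_apply']
    exact (lt_add_one _).trans_le
      (Ordinal.le_iSup (fun a : Set.Iio (m^[n] (γ + 1)) => g a + 1) ⟨a, hn⟩)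

theorem zfIsCardinal_of_closed {κ : Ordinal.{u}} (h : ∀ a < κ, (Order.succ a.card).ord < κ) :
    ZFIsCardinal κ.toZFSet := by
  refine ⟨ZFSet.isOrdinal_toZFSet _, fun β hβ => ?_⟩
  obtain ⟨a, ha, rfl⟩ := Ordinal.mem_toZFSet_iff.1 hβ
  have hlt : a.card < κ.card :=
    (Order.succ_le_iff.1 (Cardinal.ord_le.1 (h a ha).le))
  change Cardinal.mk ↥a.toZFSet < Cardinal.mk ↥κ.toZFSet
  rw [ZFSet.cardinalMk_coe_sort, ZFSet.cardinalMk_coe_sort, Cardinal.lift_lt,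
    Ordinal.card_toZFSet, Ordinal.card_toZFSet]
  exact hlt

theorem VopenkaPrinciple.exists_aExtendible (h : VopenkaPrinciple.{u}) (A : Set ZFSet.{u}) :
    ∃ α : ZFSet.{u}, AExtendible A α := by
  by_contra! hcon
  have hf : ∀ a : Ordinal.{u}, ∃ η : Ordinal.{u}, ZFIsCardinal a.toZFSet →
      a < η ∧ ¬EtaExtendibleFor A a.toZFSet η.toZFSet := by
    intro a
    by_contra! hall
    refine hcon a.toZFSet ⟨(hall 0).1, fun η hη haη => ?_⟩
    obtain ⟨η, rfl⟩ := ZFSet.isOrdinal_iff_mem_range_toZFSet.1 hη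
    exact (hall η).2 (Ordinal.toZFSet_mem_toZFSet_iff.1 haη)
  choose f hf using hf
  let g : Ordinal.{u} → Ordinal.{u} := fun a => max (f a) (Order.succ a.card).ord
  obtain ⟨c, hc⟩ := exists_ladderSystem.{u}
  have hw : ∀ a, ∃ x, IsLeast {x | a ≤ x ∨ a ≤ g x} x := fun a =>
    ⟨_, isLeast_csInf ⟨a, .inl le_rfl⟩⟩
  choose w hw using hw
  choose b hb hbg using fun γ => exists_closed_gt (fun a => max (g a) (a + 1)) γ
  let D : Ordinal.{u} → Set ZFSet.{u} := fun ξ => {x | x.rank < ξ}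
  let str : ∀ ξ, LStd.Structure (D ξ) := fun ξ => VStructure ξ A
  let F : Option (Option ℕ) → Ordinal.{u} → Ordinal.{u} := fun i =>
    match i with
    | none => g
    | some none => w
    | some (some n) => c n
  obtain ⟨d, hd⟩ := exists_surjective_formula
  let Q : ℕ ⊕ Option (Option ℕ) → Set (List ZFSet.{u}) :=
    Sum.elim (fun n => satRel D str (d n))
      (fun i => {l | ∃ σ, l = [σ.toZFSet, (F i σ).toZFSet]})
  obtain ⟨γ, δ, hne, j, hmem, hQ, hγδ⟩ :=
    h.exists_map b hb (fun γ a ha => (le_max_right _ _).trans_lt (hbg γ a ha)) Q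
  have hord : ∀ {σ : Ordinal.{u}}, σ < b γ → σ.toZFSet.rank < b γ := fun hσ => by
    rwa [Ordinal.rank_toZFSet]
  have hg : ∀ a < b γ, g a < b γ := fun a ha => (le_max_left _ _).trans_lt (hbg γ a ha)
  have hF : ∀ i σ (hσ : σ < b γ) (hFσ : F i σ < b γ), ∃ τ : Ordinal.{u},
      (j ⟨σ.toZFSet, hord hσ⟩).1 = τ.toZFSet ∧ (j ⟨_, hord hFσ⟩).1 = (F i τ).toZFSet := by
    intro i σ hσ hFσ
    obtain ⟨τ, hτ⟩ := (hQ (.inr i) [⟨σ.toZFSet, hord hσ⟩, ⟨_, hord hFσ⟩]).2 ⟨σ, rfl⟩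
    simp only [List.map_cons, List.map_nil, List.cons.injEq, and_true] at hτ
    exact ⟨τ, hτ.1, hτ.2⟩
  have hJ : ∀ σ, ∃ τ : Ordinal.{u}, ∀ hσ : σ < b γ,
      (j ⟨σ.toZFSet, hord hσ⟩).1 = τ.toZFSet := by
    intro σ
    by_cases hσ : σ < b γ
    · obtain ⟨τ, hτ, -⟩ := hF none σ hσ (hg σ hσ)
      exact ⟨τ, fun _ => hτ⟩
    · exact ⟨0, fun h => absurd h hσ⟩
  choose J hJ using hJ
  have hJF : ∀ i, ∀ σ < b γ, F i σ < b γ → J (F i σ) = F i (J σ) := by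
    intro i σ hσ hFσ
    obtain ⟨τ, h1, h2⟩ := hF i σ hσ hFσ
    rw [hJ _ hσ] at h1
    rw [hJ _ hFσ, ← Ordinal.toZFSet_injective h1] at h2
    exact Ordinal.toZFSet_injective h2
  have hJlt : ∀ σ < b γ, ∀ τ < b γ, J σ < J τ ↔ σ < τ := by
    intro σ hσ τ hτ
    have := hmem ⟨σ.toZFSet, hord hσ⟩ ⟨τ.toZFSet, hord hτ⟩
    rwa [hJ _ hσ, hJ _ hτ, Ordinal.toZFSet_mem_toZFSet_iff,
      Ordinal.toZFSet_mem_toZFSet_iff] at this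
  have hJγ : J γ = δ := by
    have := hγδ ⟨γ.toZFSet, hord (hb γ)⟩ rfl
    rw [hJ _ (hb γ)] at this
    exact Ordinal.toZFSet_injective this
  obtain ⟨κ, hκ, hfix, hclosed, hlt, hgκ⟩ := exists_critical_point hc hw hJlt
    (fun n => hJF (some (some n))) (hJF (some none)) (hJF none) hg (hb γ)
    (by rw [hJγ]; exact hne.symm)
  obtain ⟨hκη, hnot⟩ :=
    hf κ (zfIsCardinal_of_closed fun a ha => (le_max_right _ _).trans_lt (hclosed a ha))
  have hfg : f κ ≤ g κ := le_max_left _ _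
  have hη : f κ < b γ := hfg.trans_lt (hg κ hκ)
  refine hnot ?_
  obtain ⟨ζ, hζ, hemb⟩ := exists_elementaryEmbedding_of_satRel (D := D) (S := str)
    Subtype.val_injective j
    (fun p l => by
      obtain ⟨n, rfl⟩ := hd p
      exact hQ (.inl n) l)
    (ξ := f κ) (e := ⟨_, hord hη⟩) rfl (fun x hx => ⟨⟨x, (show x.rank < f κ from hx).trans hη⟩, rfl⟩)
  refine ⟨ζ.toZFSet, ZFSet.isOrdinal_toZFSet _, ?_⟩
  unfold ExtWitness
  rw [Ordinal.rank_toZFSet, Ordinal.rank_toZFSet]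
  let _ := VStructure (f κ) A
  let _ := VStructure ζ A
  obtain ⟨k, hk⟩ := hemb
  refine ⟨k, ?_, ?_⟩
  · intro β hβ hβκ
    obtain ⟨a, ha, rfl⟩ := Ordinal.mem_toZFSet_iff.1 hβκ
    have hab := ha.trans hκ
    refine (hk ⟨_, hβ⟩ ⟨_, hord hab⟩ rfl).trans ?_
    rw [hJ _ hab, hfix a ha]
  · intro hα
    have : (k ⟨κ.toZFSet, hα⟩).1 = (J κ).toZFSet :=
      (hk ⟨_, hα⟩ ⟨_, hord hκ⟩ rfl).trans (hJ _ hκ)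
    rw [this]
    exact ⟨fun h => hlt.ne' (Ordinal.toZFSet_injective h),
      Ordinal.toZFSet_mem_toZFSet_iff.2 (hfg.trans_lt hgκ)⟩

/-- Lemma 13 (`VPeq`): the following are equivalent: (1) Vopěnka's Principle; (2) for every
proper class `A` there is an `A`-extendible cardinal; (3) for every proper class `B` of ordinal
`L_std`-structures there exist `M, N ∈ B` whose domains have different cardinalities and an
`L_std`-elementary embedding `j : M → N`. -/
theorem vopenkaPrinciple_tfae :
    (VopenkaPrinciple.{u} ↔
        ∀ A : Set ZFSet.{u}, IsProperClass A → ∃ α : ZFSet.{u}, AExtendible A α) ∧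
      (VopenkaPrinciple.{u} ↔
        ∀ B : Set ZFSet.{u}, IsProperClass B → (∀ x ∈ B, IsOrdinalLStdCode x) →
          ∃ M ∈ B, ∃ N ∈ B, ElemEmbeddableDiffCard M N) := by
  exact ⟨⟨fun h A _ => h.exists_aExtendible A, vopenkaPrinciple_of_aExtendible⟩,
    ⟨fun h B hB hcode => h.ordinal B hB hcode, vopenkaPrinciple_of_ordinal⟩⟩
end
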